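/- arXiv:1809.08679 — 3 statements merged into one kernel-verified Lean document; each statement's English description precedes it below -/
import Mathlib

section
/- Maximum principle, case k=1, σ>1 (Theorem 2.9(c)): Suppose H satisfies Conditions A–C with k₁ = 0 (so k = 1, γ = 2; H(q,X) is then independent of q and is written H(X)) and Λ^sup < ∞. Let h : ℝⁿ → ℝ be continuous with sup_{ℝⁿ} h < ∞, let m ∈ ℝ, let Z : [m,∞) → [0,∞) be continuous and non-increasing, let χ : (0,T) → ℝ be bounded and continuous, and let 1 < σ < ∞. Let u be upper semicontinuous on ℝⁿ × [0,T) with inf u > m, a viscosity subsolution of H(D²u + Z(u)Du⊗Du) + χ(t)|Du|^σ − u_t = 0 in ℝⁿ_T, with u(x,0) ≤ h(x) for all x ∈ ℝⁿ. If sup_{B^R_T} u = o(R^{σ*}) as R → ∞, then u(x,t) ≤ sup_{ℝⁿ} h for all (x,t) ∈ ℝⁿ_T. -/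
open Set MeasureTheory

noncomputable section

/-- The rank-one matrix `q ⊗ q`. -/
def outerProd {n : ℕ} (q : EuclideanSpace ℝ (Fin n)) : Matrix (Fin n) (Fin n) ℝ :=
  Matrix.of fun i j => q i * q j

/-- The Loewner partial order on real matrices: `X ≤ Y` iff `Y - X` is positive semidefinite. -/
def LoewnerLE {n : ℕ} (X Y : Matrix (Fin n) (Fin n) ℝ) : Prop := (Y - X).PosSemidef

/-- Conditions A (monotonicity), B (homogeneity) and C (growth at infinity) on `H`. -/
structure ConditionsABC (n : ℕ)
    (H : EuclideanSpace ℝ (Fin n) → Matrix (Fin n) (Fin n) ℝ → ℝ) (k₁ : ℝ) : Prop where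
  continuous : Continuous fun p : EuclideanSpace ℝ (Fin n) × Matrix (Fin n) (Fin n) ℝ => H p.1 p.2
  monotone : ∀ q X Y, X.IsSymm → Y.IsSymm → LoewnerLE X Y → H q X ≤ H q Y
  zero_eq : ∀ q, H q 0 = 0
  k₁_nonneg : 0 ≤ k₁
  hom_q : ∀ (θ : ℝ) (q : EuclideanSpace ℝ (Fin n)) (X), H (θ • q) X = |θ| ^ k₁ * H q X
  hom_X : ∀ (θ : ℝ), 0 < θ → ∀ q X, H q (θ • X) = θ * H q X
  max_neg : ∀ e : EuclideanSpace ℝ (Fin n), ‖e‖ = 1 → H e (-1) < 0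
  min_pos : ∀ e : EuclideanSpace ℝ (Fin n), ‖e‖ = 1 → 0 < H e 1

/-- `Λ^sup = sup_λ max_{|e|=1} H(e, λ e⊗e + I) < ∞`. -/
def LambdaSupFinite (n : ℕ)
    (H : EuclideanSpace ℝ (Fin n) → Matrix (Fin n) (Fin n) ℝ → ℝ) : Prop :=
  ∃ C : ℝ, ∀ (lam : ℝ) (e : EuclideanSpace ℝ (Fin n)), ‖e‖ = 1 →
    H e (lam • outerProd e + 1) ≤ C

/-- `Λ^inf = inf_λ min_{|e|=1} H(e, λ e⊗e - I) > -∞`. -/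
def LambdaInfFinite (n : ℕ)
    (H : EuclideanSpace ℝ (Fin n) → Matrix (Fin n) (Fin n) ℝ → ℝ) : Prop :=
  ∃ C : ℝ, ∀ (lam : ℝ) (e : EuclideanSpace ℝ (Fin n)), ‖e‖ = 1 →
    C ≤ H e (lam • outerProd e - 1)

/-- The spatial gradient of `ψ` at `x`, as a vector in `ℝⁿ`. -/
def spaceGrad {n : ℕ} (ψ : EuclideanSpace ℝ (Fin n) → ℝ) (x : EuclideanSpace ℝ (Fin n)) :
    EuclideanSpace ℝ (Fin n) :=
  (EuclideanSpace.equiv (Fin n) ℝ).symm fun i => fderiv ℝ ψ x (EuclideanSpace.single i 1)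

/-- The spatial Hessian matrix of `ψ` at `x`. -/
def spaceHess {n : ℕ} (ψ : EuclideanSpace ℝ (Fin n) → ℝ) (x : EuclideanSpace ℝ (Fin n)) :
    Matrix (Fin n) (Fin n) ℝ :=
  Matrix.of fun i j =>
    fderiv ℝ (fun y => fderiv ℝ ψ y (EuclideanSpace.single j 1)) x (EuclideanSpace.single i 1)

/-- Viscosity subsolution of `F(t, u, Du, D²u, u_t) = 0` on `Ω ⊆ ℝⁿ × ℝ`, tested against
functions `φ(x,t)` that are C² in `x` and C¹ in `t`: whenever `u - φ` has a local maximum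
at `(x₀,t₀) ∈ Ω`, one has `F(t₀, u(x₀,t₀), Dφ, D²φ, φ_t) ≥ 0` there. -/
def ParabolicSubsolution {n : ℕ}
    (F : ℝ → ℝ → EuclideanSpace ℝ (Fin n) → Matrix (Fin n) (Fin n) ℝ → ℝ → ℝ)
    (Ω : Set (EuclideanSpace ℝ (Fin n) × ℝ)) (u : EuclideanSpace ℝ (Fin n) × ℝ → ℝ) : Prop :=
  ∀ φ : EuclideanSpace ℝ (Fin n) → ℝ → ℝ,
    (∀ t, ContDiff ℝ 2 fun x => φ x t) →
    (∀ x, ContDiff ℝ 1 fun t => φ x t) →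
    ∀ x₀ t₀, (x₀, t₀) ∈ Ω →
      IsLocalMaxOn (fun p => u p - φ p.1 p.2) Ω (x₀, t₀) →
      0 ≤ F t₀ (u (x₀, t₀)) (spaceGrad (fun x => φ x t₀) x₀) (spaceHess (fun x => φ x t₀) x₀)
          (deriv (φ x₀) t₀)

/-- Viscosity supersolution of `F(t, u, Du, D²u, u_t) = 0` on `Ω ⊆ ℝⁿ × ℝ`. -/
def ParabolicSupersolution {n : ℕ}
    (F : ℝ → ℝ → EuclideanSpace ℝ (Fin n) → Matrix (Fin n) (Fin n) ℝ → ℝ → ℝ)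
    (Ω : Set (EuclideanSpace ℝ (Fin n) × ℝ)) (u : EuclideanSpace ℝ (Fin n) × ℝ → ℝ) : Prop :=
  ∀ φ : EuclideanSpace ℝ (Fin n) → ℝ → ℝ,
    (∀ t, ContDiff ℝ 2 fun x => φ x t) →
    (∀ x, ContDiff ℝ 1 fun t => φ x t) →
    ∀ x₀ t₀, (x₀, t₀) ∈ Ω →
      IsLocalMinOn (fun p => u p - φ p.1 p.2) Ω (x₀, t₀) →
      F t₀ (u (x₀, t₀)) (spaceGrad (fun x => φ x t₀) x₀) (spaceHess (fun x => φ x t₀) x₀)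
          (deriv (φ x₀) t₀) ≤ 0

lemma mp_H_bound {n : ℕ} (hn : 2 ≤ n)
    {H : EuclideanSpace ℝ (Fin n) → Matrix (Fin n) (Fin n) ℝ → ℝ}
    (hH : ConditionsABC n H 0) {C : ℝ}
    (hC : ∀ (lam : ℝ) (e : EuclideanSpace ℝ (Fin n)), ‖e‖ = 1 →
      H e (lam • outerProd e + 1) ≤ C)
    (μ c : ℝ) (hc : 0 < c) (v : EuclideanSpace ℝ (Fin n)) :
    H 0 (μ • outerProd v + c • 1) ≤ c * C := by
  have hq : ∀ q X, H q X = H 0 X := by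
    intro q X
    have := hH.hom_q 0 q X
    simp at this
    exact this.symm
  have key : ∃ (e : EuclideanSpace ℝ (Fin n)) (lam : ℝ), ‖e‖ = 1 ∧
      μ • outerProd v = lam • outerProd e := by
    by_cases hv : v = 0
    · refine ⟨EuclideanSpace.single ⟨0, by omega⟩ 1, 0, by simp, ?_⟩
      ext i j
      simp [outerProd, hv]
    · have hv' : ‖v‖ ≠ 0 := norm_ne_zero_iff.mpr hv
      refine ⟨‖v‖⁻¹ • v, μ * ‖v‖ ^ 2, ?_, ?_⟩
      · rw [norm_smul, norm_inv, norm_norm, inv_mul_cancel₀ hv']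
      · ext i j
        simp [outerProd]
        field_simp
  obtain ⟨e, lam, he, hlam⟩ := key
  have h1 := hH.hom_X c hc 0 ((lam / c) • outerProd e + 1)
  have h2 : c • ((lam / c) • outerProd e + (1 : Matrix (Fin n) (Fin n) ℝ))
      = lam • outerProd e + c • 1 := by
    rw [smul_add, smul_smul]
    congr 2
    field_simp
  rw [hlam, ← h2, h1, ← hq e]
  exact mul_le_mul_of_nonneg_left (hC _ e he) hc.le

lemma mp_hasFDerivAt {n : ℕ} (z : EuclideanSpace ℝ (Fin n)) (p : ℝ)
    (x : EuclideanSpace ℝ (Fin n)) :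
    HasFDerivAt (fun y => (1 + ‖y - z‖ ^ 2) ^ p)
      ((p * (1 + ‖x - z‖ ^ 2) ^ (p - 1)) • ((2 : ℝ) • innerSL ℝ (x - z))) x := by
  have h1 : HasFDerivAt (fun y : EuclideanSpace ℝ (Fin n) => 1 + ‖y - z‖ ^ 2)
      ((2 : ℝ) • innerSL ℝ (x - z)) x := by
    have := (((hasFDerivAt_id (𝕜 := ℝ) x).sub_const z).norm_sq).const_add 1
    refine this.congr_fderiv ?_
    ext w
    simp
  exact h1.rpow_const (Or.inl (by positivity))

lemma mp_fderiv_single {n : ℕ} (z : EuclideanSpace ℝ (Fin n)) (p a b : ℝ)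
    (x : EuclideanSpace ℝ (Fin n)) (j : Fin n) :
    fderiv ℝ (fun y => a + b * (1 + ‖y - z‖ ^ 2) ^ p) x (EuclideanSpace.single j 1)
      = (2 * p * b) * ((1 + ‖x - z‖ ^ 2) ^ (p - 1) * (x j - z j)) := by
  have := (((mp_hasFDerivAt z p x).const_mul b).const_add a).fderiv
  rw [this]
  simp [EuclideanSpace.inner_single_right]
  ring

lemma mp_grad {n : ℕ} (z : EuclideanSpace ℝ (Fin n)) (p a b : ℝ)
    (x : EuclideanSpace ℝ (Fin n)) :
    spaceGrad (fun y => a + b * (1 + ‖y - z‖ ^ 2) ^ p) x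
      = ((2 * p * b) * (1 + ‖x - z‖ ^ 2) ^ (p - 1)) • (x - z) := by
  ext j
  simp only [spaceGrad, mp_fderiv_single]
  simp
  ring

lemma mp_hess {n : ℕ} (z : EuclideanSpace ℝ (Fin n)) (p a b : ℝ)
    (x : EuclideanSpace ℝ (Fin n)) :
    spaceHess (fun y => a + b * (1 + ‖y - z‖ ^ 2) ^ p) x
      = ((2 * p * b) * (2 * (p - 1) * (1 + ‖x - z‖ ^ 2) ^ (p - 1 - 1))) • outerProd (x - z)
        + ((2 * p * b) * (1 + ‖x - z‖ ^ 2) ^ (p - 1)) • 1 := by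
  ext i j
  simp only [spaceHess, mp_fderiv_single, Matrix.of_apply]
  have h1 : HasFDerivAt (fun y : EuclideanSpace ℝ (Fin n) => y j - z j)
      (EuclideanSpace.proj (𝕜 := ℝ) j) x :=
    ((EuclideanSpace.proj (𝕜 := ℝ) j : EuclideanSpace ℝ (Fin n) →L[ℝ] ℝ).hasFDerivAt).sub_const (z j)
  have h2 : fderiv ℝ (fun y : EuclideanSpace ℝ (Fin n) =>
      2 * p * b * ((1 + ‖y - z‖ ^ 2) ^ (p - 1) * (y j - z j))) x = _ :=
    (((mp_hasFDerivAt z (p - 1) x).mul h1).const_mul (2 * p * b)).fderiv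
  rw [h2]
  by_cases hij : i = j
  · subst hij
    simp [EuclideanSpace.inner_single_right, outerProd]
    ring
  · have hji : j ≠ i := fun h => hij h.symm
    simp [EuclideanSpace.inner_single_right, outerProd, hij, hji, Matrix.one_apply]
    ring

set_option maxHeartbeats 2000000

/-- **Theorem 2.9(c)** (maximum principle, `k = 1`, `1 < σ < ∞`).
Since `k₁ = 0`, `H(q,X)` is independent of `q` and we write `H(X) = H(0,X)`;
`σ* = σ/(σ-1)`. -/
theorem maximum_principle_k_eq_one_sigma_gt_one
    (n : ℕ) (hn : 2 ≤ n)
    (H : EuclideanSpace ℝ (Fin n) → Matrix (Fin n) (Fin n) ℝ → ℝ)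
    (hH : ConditionsABC n H 0)
    (hΛ : LambdaSupFinite n H)
    (T : ℝ) (hT : 0 < T)
    (h : EuclideanSpace ℝ (Fin n) → ℝ) (hhcont : Continuous h)
    (hhbdd : BddAbove (Set.range h))
    (m : ℝ) (Z : ℝ → ℝ)
    (hZcont : ContinuousOn Z (Ici m)) (hZanti : AntitoneOn Z (Ici m))
    (hZnonneg : ∀ s ∈ Ici m, 0 ≤ Z s)
    (χ : ℝ → ℝ) (hχcont : ContinuousOn χ (Ioo 0 T))
    (hχbdd : BddAbove ((fun t => |χ t|) '' Ioo 0 T))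
    (σ : ℝ) (hσ : 1 < σ)
    (u : EuclideanSpace ℝ (Fin n) × ℝ → ℝ)
    (husc : UpperSemicontinuousOn u (univ ×ˢ Ico 0 T))
    (hinf : ∃ c, m < c ∧ ∀ (x : EuclideanSpace ℝ (Fin n)), ∀ t ∈ Ico 0 T, c ≤ u (x, t))
    (hsub : ParabolicSubsolution
      (fun t r q X pt => H 0 (X + Z r • outerProd q) + χ t * ‖q‖ ^ σ - pt)
      (univ ×ˢ Ioo 0 T) u)
    (hinit : ∀ x, u (x, 0) ≤ h x)
    (z : EuclideanSpace ℝ (Fin n))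
    (hgrow : ∀ ε > (0:ℝ), ∃ R₀ : ℝ, ∀ R ≥ R₀, ∀ (x : EuclideanSpace ℝ (Fin n)) (t : ℝ),
      ‖x - z‖ ≤ R → t ∈ Ioo 0 T → u (x, t) ≤ ε * R ^ (σ / (σ - 1))) :
    ∀ (x : EuclideanSpace ℝ (Fin n)), ∀ t ∈ Ioo 0 T, u (x, t) ≤ ⨆ y, h y := by
  intro x₁ t₁ ht₁
  by_contra hcon
  push Not at hcon
  set M := ⨆ y, h y with hM
  obtain ⟨C, hC⟩ := hΛ
  obtain ⟨B, hB⟩ := hχbdd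
  have hχB : ∀ t ∈ Ioo 0 T, |χ t| ≤ B := fun t ht => hB ⟨t, ht, rfl⟩
  have hB0 : 0 ≤ B := (abs_nonneg _).trans (hχB t₁ ht₁)
  have hC0 : 0 < C := by
    have he : ‖(EuclideanSpace.single (⟨0, by omega⟩ : Fin n) (1 : ℝ))‖ = 1 := by simp
    have h1 := hC 0 _ he
    have h2 := hH.min_pos _ he
    rw [zero_smul, zero_add] at h1
    linarith
  have hσ1 : 0 < σ - 1 := by linarith
  obtain ⟨p, hp⟩ : ∃ p, p = σ / (σ - 1) / 2 := ⟨_, rfl⟩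
  have hp0 : 0 < p := by rw [hp]; positivity
  have hpσ : (p - 1 + 1 / 2) * σ = p := by rw [hp]; field_simp; ring
  have h2p : 2 * p = σ / (σ - 1) := by rw [hp]; ring
  obtain ⟨K, hK⟩ : ∃ K, K = 2 * p * (C + 2) := ⟨_, rfl⟩
  have hK0 : 0 < K := by rw [hK]; positivity
  obtain ⟨α, hα⟩ : ∃ α : ℝ, α = (1 / (B + 1)) ^ (1 / (σ - 1)) := ⟨_, rfl⟩
  have hα0 : 0 < α := by rw [hα]; positivity
  have hαB : B * α ^ (σ - 1) ≤ 1 := by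
    rw [hα, ← Real.rpow_mul (by positivity), one_div_mul_cancel hσ1.ne', Real.rpow_one,
      mul_one_div, div_le_one (by positivity)]
    linarith
  obtain ⟨w, hw⟩ : ∃ w : EuclideanSpace ℝ (Fin n) → ℝ, w = fun y => (1 + ‖y - z‖ ^ 2) ^ p :=
    ⟨_, rfl⟩
  have hw0 : ∀ y, 0 < w y := fun y => by rw [hw]; positivity
  have hwc : Continuous w := by
    rw [hw]
    exact Continuous.rpow_const (by fun_prop) (fun y => Or.inl (by positivity))
  obtain ⟨gap, hgap⟩ : ∃ gap, gap = u (x₁, t₁) - M := ⟨_, rfl⟩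
  have hgap0 : 0 < gap := by rw [hgap]; linarith
  -- choice of ε and δ
  obtain ⟨ε, hε0, hεα, hεg⟩ : ∃ ε : ℝ, 0 < ε ∧ 2 * p * (ε * Real.exp (K * T)) ≤ α ∧
      ε * Real.exp (K * t₁) * w x₁ ≤ gap / 4 := by
    have e1 := Real.exp_pos (K * T)
    have e2 := mul_pos (Real.exp_pos (K * t₁)) (hw0 x₁)
    refine ⟨min (α / (2 * p * Real.exp (K * T))) (gap / 4 / (Real.exp (K * t₁) * w x₁)),
      lt_min (by positivity) (by positivity), ?_, ?_⟩
    · have := min_le_left (α / (2 * p * Real.exp (K * T)))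
        (gap / 4 / (Real.exp (K * t₁) * w x₁))
      rw [le_div_iff₀ (by positivity)] at this
      linarith
    · have := min_le_right (α / (2 * p * Real.exp (K * T)))
        (gap / 4 / (Real.exp (K * t₁) * w x₁))
      rw [le_div_iff₀ (by positivity)] at this
      linarith
  obtain ⟨δ, hδ⟩ : ∃ δ, δ = gap / 4 := ⟨_, rfl⟩
  have hδ0 : 0 < δ := by rw [hδ]; positivity
  obtain ⟨T', hT'⟩ : ∃ T', T' = (t₁ + T) / 2 := ⟨_, rfl⟩
  have hT1 : t₁ < T' := by rw [hT']; linarith [ht₁.2]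
  have hT2 : T' < T := by rw [hT']; linarith [ht₁.2]
  have ht₁0 : 0 < t₁ := ht₁.1
  have hp2 : 0 < 2 * p := by positivity
  -- choice of R
  obtain ⟨R₀, hR₀⟩ := hgrow (ε / 2) (by positivity)
  have hpow : ∀ y : EuclideanSpace ℝ (Fin n), ‖y - z‖ ^ (σ / (σ - 1)) ≤ w y := by
    intro y
    rw [hw, ← h2p, Real.rpow_mul (norm_nonneg _)]
    apply Real.rpow_le_rpow (by positivity) _ hp0.le
    rw [Real.rpow_two]
    linarith
  obtain ⟨R, hRR₀, hR1, hRM, hRx⟩ : ∃ R : ℝ, R₀ ≤ R ∧ 0 < R ∧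
      (∀ r ≥ R, -M < ε / 2 * r ^ (σ / (σ - 1))) ∧ ‖x₁ - z‖ ≤ R := by
    have h1 : Filter.Tendsto (fun r : ℝ => ε / 2 * r ^ (σ / (σ - 1))) Filter.atTop
        Filter.atTop := by
      rw [← h2p]
      exact (tendsto_rpow_atTop hp2).const_mul_atTop (by positivity)
    obtain ⟨R₂, hR₂⟩ := Filter.eventually_atTop.mp (h1.eventually_gt_atTop (-M))
    refine ⟨max (max R₀ R₂) (max 1 ‖x₁ - z‖), ?_, ?_, ?_, ?_⟩
    · exact (le_max_left _ _).trans (le_max_left _ _)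
    · exact lt_of_lt_of_le one_pos ((le_max_left _ _).trans (le_max_right _ _))
    · intro r hr
      exact hR₂ r (((le_max_right _ _).trans (le_max_left _ _)).trans hr)
    · exact (le_max_right _ _).trans (le_max_right _ _)
  obtain ⟨U, hU⟩ : ∃ U, U = ε / 2 * R ^ (σ / (σ - 1)) := ⟨_, rfl⟩
  have huU : ∀ y t, ‖y - z‖ ≤ R → t ∈ Ioo 0 T → u (y, t) ≤ U := by
    intro y t hy ht
    rw [hU]
    exact hR₀ R hRR₀ y t hy ht
  -- choice of N
  obtain ⟨N, hN0, hN⟩ : ∃ N : ℝ, 0 < N ∧ U - M < δ * Real.exp (N * (T' - t₁)) := by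
    have h1 : Filter.Tendsto (fun N : ℝ => δ * Real.exp (N * (T' - t₁))) Filter.atTop
        Filter.atTop :=
      (Real.tendsto_exp_atTop.comp
        (Filter.tendsto_id.atTop_mul_const (by linarith))).const_mul_atTop hδ0
    obtain ⟨N, h2, h3⟩ := ((Filter.eventually_gt_atTop 0).and
      (h1.eventually_gt_atTop (U - M))).exists
    exact ⟨N, h2, h3⟩
  obtain ⟨φ, hφ⟩ : ∃ φ : EuclideanSpace ℝ (Fin n) → ℝ → ℝ, φ = fun y t =>
      (M + δ * Real.exp (N * (t - t₁))) + (ε * Real.exp (K * t)) * (1 + ‖y - z‖ ^ 2) ^ p :=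
    ⟨_, rfl⟩
  have hφw : ∀ y t, φ y t = (M + δ * Real.exp (N * (t - t₁))) + (ε * Real.exp (K * t)) * w y := by
    intro y t; rw [hφ, hw]
  have hφc : Continuous fun q : EuclideanSpace ℝ (Fin n) × ℝ => φ q.1 q.2 := by
    simp only [hφw]
    fun_prop
  have hhM : ∀ y, h y ≤ M := fun y => le_ciSup hhbdd y
  -- maximum on the compact cylinder
  have hcpt : IsCompact (Metric.closedBall z R ×ˢ Icc 0 T') :=
    (isCompact_closedBall z R).prod isCompact_Icc
  have hmem : (x₁, t₁) ∈ Metric.closedBall z R ×ˢ Icc 0 T' := by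
    refine ⟨?_, ht₁.1.le, hT1.le⟩
    simpa [dist_eq_norm] using hRx
  have husc' : UpperSemicontinuousOn (fun q => u q - φ q.1 q.2)
      (Metric.closedBall z R ×ˢ Icc 0 T') := by
    have h1 : UpperSemicontinuousOn u (Metric.closedBall z R ×ˢ Icc 0 T') :=
      husc.mono (fun q hq => ⟨mem_univ _, hq.2.1, hq.2.2.trans_lt hT2⟩)
    have h2 : UpperSemicontinuousOn (fun q : EuclideanSpace ℝ (Fin n) × ℝ => - φ q.1 q.2)
      (Metric.closedBall z R ×ˢ Icc 0 T') := hφc.neg.upperSemicontinuous.upperSemicontinuousOn _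
    simpa only [sub_eq_add_neg] using h1.add h2
  obtain ⟨⟨x₀, t₀⟩, hmem0, hmax⟩ := husc'.exists_isMaxOn ⟨_, hmem⟩ hcpt
  have hpos1 : 0 < u (x₁, t₁) - φ x₁ t₁ := by
    rw [hφw, sub_self, mul_zero, Real.exp_zero]
    linarith
  have hpos0 : 0 < u (x₀, t₀) - φ x₀ t₀ := lt_of_lt_of_le hpos1 (hmax hmem)
  have hx0 : ‖x₀ - z‖ ≤ R := by simpa [dist_eq_norm] using hmem0.1
  have hMφ : ∀ y t, M + δ * Real.exp (N * (t - t₁)) < φ y t := by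
    intro y t
    rw [hφw]
    have := mul_pos (mul_pos hε0 (Real.exp_pos (K * t))) (hw0 y)
    linarith
  have ht00 : 0 < t₀ := by
    rcases hmem0.2.1.lt_or_eq with h1 | h1
    · exact h1
    · exfalso
      simp only at h1
      subst h1
      have := hinit x₀
      have := hhM x₀
      have := hMφ x₀ 0
      have : 0 < δ * Real.exp (N * (0 - t₁)) := by positivity
      linarith
  have ht0T : t₀ < T' := by
    rcases hmem0.2.2.lt_or_eq with h1 | h1
    · exact h1
    · exfalso
      simp only at h1
      subst h1
      have := huU x₀ t₀ hx0 ⟨ht00, hT2⟩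
      have := hMφ x₀ t₀
      linarith
  have ht0I : t₀ ∈ Ioo 0 T := ⟨ht00, ht0T.trans hT2⟩
  have hx0R : ‖x₀ - z‖ < R := by
    rcases hx0.lt_or_eq with h1 | h1
    · exact h1
    · exfalso
      have h2 := huU x₀ t₀ hx0 ht0I
      have h3 := hpow x₀
      have h4 := hRM R le_rfl
      have h5 := hφw x₀ t₀
      have h6 : 0 < δ * Real.exp (N * (t₀ - t₁)) := by positivity
      rw [h1] at h3
      have h7 : 1 ≤ Real.exp (K * t₀) := Real.one_le_exp (by positivity)
      have h8 : ε * R ^ (σ / (σ - 1)) ≤ (ε * Real.exp (K * t₀)) * w x₀ := by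
        apply mul_le_mul _ h3 (by positivity) (by positivity)
        nlinarith
      linarith
  have hloc : IsLocalMaxOn (fun q => u q - φ q.1 q.2) (univ ×ˢ Ioo 0 T) (x₀, t₀) := by
    have hnhds : Metric.closedBall z R ×ˢ Icc 0 T' ∈ nhds (x₀, t₀) := by
      apply prod_mem_nhds
      · exact Filter.mem_of_superset (Metric.isOpen_ball.mem_nhds
          (by simpa [dist_eq_norm] using hx0R)) Metric.ball_subset_closedBall
      · exact Icc_mem_nhds ht00 ht0T
    exact (hmax.isLocalMax hnhds).on _
  have hineq := hsub φ ?_ ?_ x₀ t₀ ⟨mem_univ _, ht0I⟩ hloc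
  rotate_left
  · intro t
    rw [hφ]
    refine contDiff_const.add (contDiff_const.mul ?_)
    refine ContDiff.rpow_const_of_ne ?_ (fun y => by positivity)
    exact contDiff_const.add ((contDiff_id.sub contDiff_const).norm_sq ℝ)
  · intro y
    rw [hφ]
    fun_prop
  have hderiv : deriv (φ x₀) t₀ = δ * N * Real.exp (N * (t₀ - t₁))
      + ε * K * Real.exp (K * t₀) * w x₀ := by
    have h1 : HasDerivAt (fun t => N * (t - t₁)) N t₀ := by
      simpa using ((hasDerivAt_id t₀).sub_const t₁).const_mul N
    have h2 : HasDerivAt (fun t => K * t) K t₀ := by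
      simpa using (hasDerivAt_id t₀).const_mul K
    have h3 := ((h1.exp.const_mul δ).const_add M).add ((h2.exp.const_mul ε).mul_const (w x₀))
    have h4 : φ x₀ = (fun t => M + δ * Real.exp (N * (t - t₁))) +
        fun t => ε * Real.exp (K * t) * w x₀ := by
      funext t
      simp [hφw]
    rw [h4, h3.deriv]
    ring
  obtain ⟨s, hs⟩ : ∃ s, s = 1 + ‖x₀ - z‖ ^ 2 := ⟨_, rfl⟩
  have hs1 : 1 ≤ s := by rw [hs]; nlinarith [sq_nonneg ‖x₀ - z‖]
  have hs0 : 0 < s := by linarith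
  obtain ⟨A, hA⟩ : ∃ A, A = 2 * p * (ε * Real.exp (K * t₀)) := ⟨_, rfl⟩
  have hA0 : 0 < A := by rw [hA]; positivity
  have hAα : A ≤ α := by
    refine le_trans ?_ hεα
    rw [hA]
    gcongr
    exact ht0I.2.le
  have hws : w x₀ = s ^ p := by rw [hw, hs]
  have hgrad : spaceGrad (fun x => φ x t₀) x₀ = (A * s ^ (p - 1)) • (x₀ - z) := by
    rw [hφ, hs, hA]
    exact mp_grad z p _ _ x₀
  have hhess : spaceHess (fun x => φ x t₀) x₀ =
      (A * (2 * (p - 1) * s ^ (p - 1 - 1))) • outerProd (x₀ - z) + (A * s ^ (p - 1)) • 1 := by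
    rw [hφ, hs, hA]
    exact mp_hess z p _ _ x₀
  simp only [hgrad, hhess, hderiv] at hineq
  have hmat : (A * (2 * (p - 1) * s ^ (p - 1 - 1))) • outerProd (x₀ - z) + (A * s ^ (p - 1)) • 1
      + Z (u (x₀, t₀)) • outerProd ((A * s ^ (p - 1)) • (x₀ - z))
      = (A * (2 * (p - 1) * s ^ (p - 1 - 1)) + Z (u (x₀, t₀)) * (A * s ^ (p - 1)) ^ 2) •
        outerProd (x₀ - z) + (A * s ^ (p - 1)) • (1 : Matrix (Fin n) (Fin n) ℝ) := by
    ext i j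
    simp [outerProd]
    ring
  rw [hmat] at hineq
  have hHb := mp_H_bound hn hH hC (A * (2 * (p - 1) * s ^ (p - 1 - 1)) +
    Z (u (x₀, t₀)) * (A * s ^ (p - 1)) ^ 2) (A * s ^ (p - 1)) (by positivity) (x₀ - z)
  have hsp : s ^ (p - 1) ≤ s ^ p := Real.rpow_le_rpow_of_exponent_le hs1 (by linarith)
  have hsp0 : 0 < s ^ p := by positivity
  have hnorm : ‖(A * s ^ (p - 1)) • (x₀ - z)‖ ^ σ ≤ A * α ^ (σ - 1) * s ^ p := by
    have h1 : ‖x₀ - z‖ ≤ s ^ (1 / 2 : ℝ) := by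
      rw [← Real.sqrt_eq_rpow]
      apply Real.le_sqrt_of_sq_le
      rw [hs]; linarith
    have h2 : ‖(A * s ^ (p - 1)) • (x₀ - z)‖ ≤ A * s ^ (p - 1 + 1 / 2) := by
      rw [norm_smul, Real.norm_of_nonneg (by positivity), Real.rpow_add hs0, ← mul_assoc]
      gcongr
    calc ‖(A * s ^ (p - 1)) • (x₀ - z)‖ ^ σ ≤ (A * s ^ (p - 1 + 1 / 2)) ^ σ :=
          Real.rpow_le_rpow (norm_nonneg _) h2 (by linarith)
      _ = A ^ σ * s ^ p := by
          rw [Real.mul_rpow hA0.le (by positivity), ← Real.rpow_mul hs0.le, hpσ]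
      _ = A * A ^ (σ - 1) * s ^ p := by
          rw [Real.rpow_sub_one hA0.ne']
          field_simp
      _ ≤ A * α ^ (σ - 1) * s ^ p := by
          gcongr
  have hχt : χ t₀ * ‖(A * s ^ (p - 1)) • (x₀ - z)‖ ^ σ ≤ A * s ^ p := by
    calc χ t₀ * ‖(A * s ^ (p - 1)) • (x₀ - z)‖ ^ σ
        ≤ B * (A * α ^ (σ - 1) * s ^ p) :=
          mul_le_mul ((le_abs_self _).trans (hχB t₀ ht0I)) hnorm (by positivity) hB0
      _ = (B * α ^ (σ - 1)) * (A * s ^ p) := by ring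
      _ ≤ 1 * (A * s ^ p) := by gcongr
      _ = A * s ^ p := one_mul _
  have hHb2 : A * s ^ (p - 1) * C ≤ A * s ^ p * C := by gcongr
  have hlast : ε * K * Real.exp (K * t₀) * w x₀ = A * s ^ p * (C + 2) := by
    rw [hws, hA]
    have : ε * K = 2 * p * (C + 2) * ε := by rw [hK]; ring
    rw [this]
    ring
  have hδN : 0 < δ * N * Real.exp (N * (t₀ - t₁)) := by positivity
  have hAs : 0 < A * s ^ p := by positivity
  rw [hlast] at hineq
  nlinarith
end
end

section
/- Minimum principle, case k=1, 0≤σ≤1 (Theorem 2.10(a),(b)): Suppose H satisfies Conditions A–C with k₁ = 0 (so k = 1, γ = 2; H(q,X) is then independent of q and is written H(X)), Λ^sup < ∞ and Λ^inf > −∞. Let h : ℝⁿ → ℝ be continuous with inf_{ℝⁿ} h > −∞, let Z : (−∞,∞) → [0,∞) be continuous and non-increasing, and let χ : (0,T) → ℝ be bounded and continuous. Let u be lower semicontinuous on ℝⁿ × [0,T), a viscosity supersolution of H(D²u + Z(u)Du⊗Du) + χ(t)|Du|^σ − u_t = 0 in ℝⁿ_T, with u(x,0) ≥ h(x) for all x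 ∈ ℝⁿ. (a) If σ = 0 and sup_{B^R_T}(−u) = e^{o(R²)} as R → ∞, then u(x,t) ≥ inf_{ℝⁿ} h − t·sup_{(0,T)}|χ(t)| for all (x,t) ∈ ℝⁿ_T. (b) If 0 < σ ≤ 1 and sup_{B^R_T}(−u) = e^{o(R)} as R → ∞, then u(x,t) ≥ inf_{ℝⁿ} h for all (x,t) ∈ ℝⁿ_T. -/
open Set MeasureTheory

noncomputable section

theorem aux_norm_sq {n : ℕ} (z x : EuclideanSpace ℝ (Fin n)) :
    HasFDerivAt (fun y : EuclideanSpace ℝ (Fin n) => 1 + ‖y - z‖ ^ 2)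
      ((2:ℝ) • innerSL ℝ (x - z)) x := by
  have h1 : HasFDerivAt (fun y : EuclideanSpace ℝ (Fin n) => y - z)
      (ContinuousLinearMap.id ℝ _) x := (hasFDerivAt_id x).sub_const z
  have h2 := (h1.norm_sq).const_add 1
  refine h2.congr_fderiv ?_
  ext v
  simp

theorem aux_fderiv {n : ℕ} (z : EuclideanSpace ℝ (Fin n)) (F F1 : ℝ → ℝ) (c : ℝ)
    (hF : ∀ τ, 0 < τ → HasDerivAt F (F1 τ) τ) (x v : EuclideanSpace ℝ (Fin n)) :
    fderiv ℝ (fun y => c + F (1 + ‖y - z‖ ^ 2)) x v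
      = F1 (1 + ‖x - z‖ ^ 2) * (2 * inner ℝ (x - z) v) := by
  have h1 := (hF (1 + ‖x - z‖ ^ 2) (by positivity)).comp_hasFDerivAt x (aux_norm_sq z x)
  have h2 := (h1.const_add c).fderiv
  simp only [Function.comp_def] at h2
  rw [h2]
  simp only [smul_eq_mul, ContinuousLinearMap.smul_apply, innerSL_apply_apply]

theorem aux_grad {n : ℕ} (z : EuclideanSpace ℝ (Fin n)) (F F1 : ℝ → ℝ) (c : ℝ)
    (hF : ∀ τ, 0 < τ → HasDerivAt F (F1 τ) τ) (x : EuclideanSpace ℝ (Fin n)) :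
    spaceGrad (fun y => c + F (1 + ‖y - z‖ ^ 2)) x
      = (2 * F1 (1 + ‖x - z‖ ^ 2)) • (x - z) := by
  ext i
  simp only [spaceGrad, aux_fderiv z F F1 c hF]
  simp [EuclideanSpace.inner_single_right]
  ring

theorem aux_hess {n : ℕ} (z : EuclideanSpace ℝ (Fin n)) (F F1 F2 : ℝ → ℝ) (c : ℝ)
    (hF : ∀ τ, 0 < τ → HasDerivAt F (F1 τ) τ) (hF1 : ∀ τ, 0 < τ → HasDerivAt F1 (F2 τ) τ)
    (x : EuclideanSpace ℝ (Fin n)) :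
    spaceHess (fun y => c + F (1 + ‖y - z‖ ^ 2)) x
      = (2 * F1 (1 + ‖x - z‖ ^ 2)) • (1 : Matrix (Fin n) (Fin n) ℝ)
        + (4 * F2 (1 + ‖x - z‖ ^ 2)) • outerProd (x - z) := by
  ext i j
  simp only [spaceHess, aux_fderiv z F F1 c hF, Matrix.of_apply]
  have h1 : HasFDerivAt (fun y : EuclideanSpace ℝ (Fin n) => F1 (1 + ‖y - z‖ ^ 2))
      (F2 (1 + ‖x - z‖ ^ 2) • ((2:ℝ) • innerSL ℝ (x - z))) x :=
    (hF1 (1 + ‖x - z‖ ^ 2) (by positivity)).comp_hasFDerivAt x (aux_norm_sq z x)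
  have h2 : HasFDerivAt (fun y : EuclideanSpace ℝ (Fin n) =>
      2 * inner ℝ (y - z) (EuclideanSpace.single j (1:ℝ)))
      ((2:ℝ) • innerSL ℝ (EuclideanSpace.single j (1:ℝ))) x := by
    have h3 := ((innerSL ℝ (EuclideanSpace.single j (1:ℝ))).hasFDerivAt (x := x - z)).comp x
      ((hasFDerivAt_id x).sub_const z)
    have h4 := h3.const_mul 2
    have h5 := h4.congr_fderiv (g' := (2:ℝ) • innerSL ℝ (EuclideanSpace.single j (1:ℝ)))
      (by ext v; simp)
    refine h5.congr_of_eventuallyEq (Filter.Eventually.of_forall fun y => ?_)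
    simp only [Function.comp_apply, innerSL_apply_apply, id]
    rw [real_inner_comm]
  have h5 := (h1.mul h2).fderiv
  erw [h5]
  simp [EuclideanSpace.inner_single_right, EuclideanSpace.inner_single_left, outerProd,
    Matrix.one_apply, Pi.single_apply]
  by_cases hij : i = j
  · subst hij; simp; ring
  · have : ¬ j = i := fun h => hij h.symm
    simp [hij, this]; ring

theorem aux_outer_symm {n : ℕ} (q : EuclideanSpace ℝ (Fin n)) : (outerProd q).IsSymm := by
  ext i j; simp [outerProd, mul_comm]

theorem aux_outer_psd {n : ℕ} (q : EuclideanSpace ℝ (Fin n)) : (outerProd q).PosSemidef := by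
  have := Matrix.posSemidef_vecMulVec_self_star (R := ℝ) (fun i => q i)
  have h2 : outerProd q = Matrix.vecMulVec (fun i => q i) (star fun i => q i) := by
    ext i j; simp [outerProd, Matrix.vecMulVec]
  rw [h2]; exact this

theorem aux_outer_smul {n : ℕ} (c : ℝ) (q : EuclideanSpace ℝ (Fin n)) :
    outerProd (c • q) = (c ^ 2) • outerProd q := by
  ext i j; simp [outerProd]; ring

theorem aux_H_indep {n : ℕ} {H : EuclideanSpace ℝ (Fin n) → Matrix (Fin n) (Fin n) ℝ → ℝ}
    (hH : ConditionsABC n H 0) (q : EuclideanSpace ℝ (Fin n)) (X) : H 0 X = H q X := by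
  have := hH.hom_q 0 q X
  simpa using this

theorem aux_H_lower {n : ℕ} (hn : 2 ≤ n)
    {H : EuclideanSpace ℝ (Fin n) → Matrix (Fin n) (Fin n) ℝ → ℝ}
    (hH : ConditionsABC n H 0) {C : ℝ} (hC : ∀ (lam : ℝ) (e : EuclideanSpace ℝ (Fin n)), ‖e‖ = 1 →
    C ≤ H e (lam • outerProd e - 1)) (A B ζ : ℝ) (hA : A < 0) (hζ : 0 ≤ ζ)
    (y q : EuclideanSpace ℝ (Fin n)) :
    A * |C| ≤ H 0 (A • (1 : Matrix (Fin n) (Fin n) ℝ) + B • outerProd y + ζ • outerProd q) := by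
  have hlow : ∀ lam : ℝ, ∀ y : EuclideanSpace ℝ (Fin n), -|C| ≤ H 0 (lam • outerProd y - 1) := by
    intro lam y
    refine (neg_abs_le C).trans ?_
    by_cases hy : y = 0
    · subst hy
      let e : EuclideanSpace ℝ (Fin n) := EuclideanSpace.single ⟨0, by omega⟩ 1
      have h1 := hC 0 e (by simp [e])
      rw [← aux_H_indep hH e] at h1
      have : outerProd (0 : EuclideanSpace ℝ (Fin n)) = 0 := by ext i j; simp [outerProd]
      simpa [this] using h1
    · have hy' : ‖y‖ ≠ 0 := norm_ne_zero_iff.2 hy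
      have h1 := hC (lam * ‖y‖ ^ 2) (‖y‖⁻¹ • y) (by
        rw [norm_smul, norm_inv, norm_norm]; exact inv_mul_cancel₀ hy')
      rw [← aux_H_indep hH, aux_outer_smul, smul_smul] at h1
      have h2 : lam * ‖y‖ ^ 2 * ‖y‖⁻¹ ^ 2 = lam := by
        rw [mul_assoc, ← mul_pow, mul_inv_cancel₀ hy', one_pow, mul_one]
      rwa [h2] at h1
  have h1 : H 0 (A • (1 : Matrix (Fin n) (Fin n) ℝ) + B • outerProd y)
      ≤ H 0 (A • (1 : Matrix (Fin n) (Fin n) ℝ) + B • outerProd y + ζ • outerProd q) := by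
    apply hH.monotone
    · exact (Matrix.isSymm_one.smul _).add ((aux_outer_symm y).smul _)
    · exact ((Matrix.isSymm_one.smul _).add ((aux_outer_symm y).smul _)).add
        ((aux_outer_symm q).smul _)
    · unfold LoewnerLE
      rw [add_sub_cancel_left]
      exact (aux_outer_psd q).smul hζ
  refine le_trans ?_ h1
  have h2 : A • (1 : Matrix (Fin n) (Fin n) ℝ) + B • outerProd y
      = (-A) • ((B / (-A)) • outerProd y - 1) := by
    rw [smul_sub, smul_smul, mul_div_cancel₀ _ (by linarith)]
    simp [add_comm]
  rw [h2, hH.hom_X _ (by linarith)]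
  have := hlow (B / (-A)) y
  nlinarith

theorem aux_pen (t₁ : ℝ) (t : ℝ) :
    HasDerivAt (fun t : ℝ => (max (t - t₁) 0) ^ 2) (2 * max (t - t₁) 0) t := by
  rcases lt_trichotomy t t₁ with h | h | h
  · have : max (t - t₁) 0 = 0 := max_eq_right (by linarith)
    rw [this, mul_zero]
    refine (hasDerivAt_const t (0:ℝ)).congr_of_eventuallyEq ?_
    filter_upwards [Iio_mem_nhds h] with s hs
    have : max (s - t₁) 0 = 0 := max_eq_right (by linarith [mem_Iio.1 hs])
    simp [this]
  · subst h
    simp only [sub_self, max_self, mul_zero]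
    rw [hasDerivAt_iff_isLittleO]
    simp only [sub_self, max_self, smul_zero, sub_zero]
    have h1 : (fun s : ℝ => max (s - t) 0 ^ 2 - 0 ^ 2) =O[nhds t] fun s => (s - t) ^ 2 := by
      refine Asymptotics.isBigO_of_le _ fun s => ?_
      rcases le_total (s - t) 0 with h | h
      · rw [max_eq_right h]; simp [sq_nonneg]
      · rw [max_eq_left h]; simp
    refine h1.trans_isLittleO ?_
    have := (Asymptotics.isLittleO_pow_sub_sub (E' := ℝ) t (m := 2) (by norm_num))
    rw [← Asymptotics.isLittleO_norm_left]
    simpa using this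
  · have : max (t - t₁) 0 = t - t₁ := max_eq_left (by linarith)
    rw [this]
    have h1 : HasDerivAt (fun s : ℝ => (s - t₁) ^ 2) (2 * (t - t₁)) t := by
      have h2 := ((hasDerivAt_id t).sub_const t₁).fun_pow 2
      simpa using h2
    refine h1.congr_of_eventuallyEq ?_
    filter_upwards [Ioi_mem_nhds h] with s hs
    rw [max_eq_left (by linarith [mem_Ioi.1 hs])]

theorem aux_pen_contDiff (t₁ : ℝ) : ContDiff ℝ 1 (fun t : ℝ => (max (t - t₁) 0) ^ 2) := by
  rw [contDiff_one_iff_deriv]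
  refine ⟨fun t => (aux_pen t₁ t).differentiableAt, ?_⟩
  have : deriv (fun t : ℝ => (max (t - t₁) 0) ^ 2) = fun t => 2 * max (t - t₁) 0 :=
    funext fun t => (aux_pen t₁ t).deriv
  rw [this]
  fun_prop

theorem aux_time (m c N t₁ δ K g t₀ : ℝ) :
    HasDerivAt (fun t : ℝ => (m - t * c - N * (max (t - t₁) 0) ^ 2)
        + -(δ * Real.exp (Real.exp (K * t) * g)))
      (-c - N * (2 * max (t₀ - t₁) 0)
        - δ * (Real.exp (Real.exp (K * t₀) * g) * (Real.exp (K * t₀) * K * g))) t₀ := by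
  have h1 := (aux_pen t₁ t₀).const_mul N
  have h0 : HasDerivAt (fun t : ℝ => K * t) K t₀ := by
    simpa using (hasDerivAt_id t₀).const_mul K
  have h2 : HasDerivAt (fun t : ℝ => Real.exp (K * t)) (Real.exp (K * t₀) * K) t₀ := h0.exp
  have h3 := (((h2.mul_const g).exp).const_mul δ).fun_neg
  have h5 : HasDerivAt (fun t : ℝ => t * c) c t₀ := by
    simpa using (hasDerivAt_id t₀).mul_const c
  have h4 := ((h5.const_sub m).fun_sub h1).fun_add h3
  refine h4.congr_deriv ?_
  ring

theorem aux_young (σ : ℝ) (h0 : 0 < σ) (h1 : σ ≤ 1) (η : ℝ) (hη : 0 < η) :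
    ∃ L : ℝ, 0 ≤ L ∧ ∀ r : ℝ, 0 ≤ r → r ^ σ ≤ η + L * r := by
  -- scale so that `θ ^ σ = η`
  obtain ⟨θ, hθ, hθσ⟩ : ∃ θ : ℝ, 0 < θ ∧ θ ^ σ = η :=
    ⟨η ^ σ⁻¹, by positivity, by rw [← Real.rpow_mul hη.le, inv_mul_cancel₀ h0.ne', Real.rpow_one]⟩
  refine ⟨η / θ, by positivity, fun r hr => ?_⟩
  have h2 : (r / θ) ^ σ ≤ 1 + r / θ := by
    have hq : 0 ≤ r / θ := by positivity
    rcases le_total (r / θ) 1 with h | h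
    · exact (Real.rpow_le_one hq h h0.le).trans (by linarith)
    · have := Real.rpow_le_rpow_of_exponent_le h h1
      rw [Real.rpow_one] at this
      linarith
  rw [Real.div_rpow hr hθ.le, hθσ, div_le_iff₀ hη] at h2
  calc r ^ σ ≤ _ := h2
    _ = _ := by ring

set_option maxHeartbeats 1000000 in
theorem aux_core
    (n : ℕ) (hn : 2 ≤ n)
    (H : EuclideanSpace ℝ (Fin n) → Matrix (Fin n) (Fin n) ℝ → ℝ)
    (hH : ConditionsABC n H 0) (hΛinf : LambdaInfFinite n H)
    (T : ℝ)
    (Z : ℝ → ℝ) (hZnonneg : ∀ s, 0 ≤ Z s)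
    (χ : ℝ → ℝ) (M : ℝ) (hM0 : 0 ≤ M) (hχ : ∀ t ∈ Ioo 0 T, |χ t| ≤ M)
    (σ : ℝ)
    (u : EuclideanSpace ℝ (Fin n) × ℝ → ℝ)
    (hlsc : LowerSemicontinuousOn u (univ ×ˢ Ico 0 T))
    (hsuper : ParabolicSupersolution
      (fun t r q X pt => H 0 (X + Z r • outerProd q) + χ t * ‖q‖ ^ σ - pt)
      (univ ×ˢ Ioo 0 T) u)
    (m : ℝ) (hinit : ∀ x, m ≤ u (x, 0))
    (z : EuclideanSpace ℝ (Fin n)) (η L : ℝ) (hη : 0 ≤ η) (hL : 0 ≤ L)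
    (hyoung : ∀ r : ℝ, 0 ≤ r → r ^ σ ≤ η + L * r)
    (p : ℝ) (hp0 : 0 < p) (hp1 : p ≤ 1)
    (hgrow : ∃ B : ℝ, ∀ x, ∀ t ∈ Ioo 0 T,
      -u (x, t) ≤ B + Real.exp ((1 + ‖x - z‖ ^ 2) ^ p / 2))
    (x₁ : EuclideanSpace ℝ (Fin n)) (t₁ : ℝ) (ht₁ : t₁ ∈ Ioo 0 T) :
    m - t₁ * (η * M) ≤ u (x₁, t₁) := by
  by_contra! hcon
  obtain ⟨B, hB⟩ := hgrow
  obtain ⟨C, hC⟩ := hΛinf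
  obtain ⟨ht0, htT⟩ := ht₁
  set K : ℝ := 2 * |C| + 2 * (M * L) + 1 with hK
  have hKpos : 0 < K := by positivity
  set w : EuclideanSpace ℝ (Fin n) → ℝ → ℝ :=
    fun x t => Real.exp (Real.exp (K * t) * (1 + ‖x - z‖ ^ 2) ^ p) with hw
  have hwpos : ∀ x t, 0 < w x t := fun x t => Real.exp_pos _
  -- choice of δ
  obtain ⟨δ, hδ, hδ1⟩ : ∃ δ : ℝ, 0 < δ ∧ u (x₁, t₁) + δ * w x₁ t₁ < m - t₁ * (η * M) := by
    refine ⟨(m - t₁ * (η * M) - u (x₁, t₁)) / (2 * w x₁ t₁), ?_, ?_⟩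
    · exact div_pos (by linarith) (by linarith [hwpos x₁ t₁])
    · have := (hwpos x₁ t₁).ne'
      have h3 : (m - t₁ * (η * M) - u (x₁, t₁)) / (2 * w x₁ t₁) * w x₁ t₁
        = (m - t₁ * (η * M) - u (x₁, t₁)) / 2 := by field_simp
      rw [h3]; linarith
  have hgle : ∀ x, ∀ t, 0 ≤ t → Real.exp ((1 + ‖x - z‖ ^ 2) ^ p / 2) ^ 2 ≤ w x t := by
    intro x t ht
    rw [← Real.exp_nat_mul, hw]
    apply Real.exp_le_exp.2
    have h1 : 1 ≤ Real.exp (K * t) := Real.one_le_exp (by positivity)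
    have h2 : 0 ≤ (1 + ‖x - z‖ ^ 2) ^ p := by positivity
    push_cast
    nlinarith
  set T' := (t₁ + T) / 2 with hT'
  have h1T' : t₁ < T' := by rw [hT']; linarith
  have hT'T : T' < T := by rw [hT']; linarith
  -- penalization constant
  obtain ⟨N, hN0, hN⟩ : ∃ N : ℝ, 0 ≤ N ∧ B + 1 / (4 * δ) + m ≤ N * (T' - t₁) ^ 2 := by
    refine ⟨|B + 1 / (4 * δ) + m| / (T' - t₁) ^ 2, by positivity, ?_⟩
    have : (T' - t₁) ^ 2 ≠ 0 := pow_ne_zero _ (by linarith)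
    rw [div_mul_cancel₀ _ this]
    exact le_abs_self _
  set G : EuclideanSpace ℝ (Fin n) × ℝ → ℝ := fun q =>
    u q + (q.2 * (η * M) + δ * w q.1 q.2 + N * (max (q.2 - t₁) 0) ^ 2 - m) with hG
  have hG1 : G (x₁, t₁) < 0 := by
    simp only [hG, sub_self, max_self]
    linarith
  have hηM : 0 ≤ η * M := by positivity
  have hGlow : ∀ x, ∀ t ∈ Ioo 0 T, δ * Real.exp ((1 + ‖x - z‖ ^ 2) ^ p / 2) ^ 2
      - Real.exp ((1 + ‖x - z‖ ^ 2) ^ p / 2) - B + N * (max (t - t₁) 0) ^ 2 - m ≤ G (x, t) := by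
    intro x t ht
    have h1 := hB x t ht
    have h2 := mul_le_mul_of_nonneg_left (hgle x t ht.1.le) hδ.le
    have h3 : 0 ≤ t * (η * M) := mul_nonneg ht.1.le hηM
    simp only [hG]
    linarith
  have hG0 : ∀ x, 0 < G (x, 0) := by
    intro x
    have h1 := mul_pos hδ (hwpos x 0)
    have h2 := hinit x
    have h3 : 0 ≤ N * (max (0 - t₁) 0) ^ 2 := by positivity
    simp only [hG]
    linarith
  have hGT : ∀ x, 0 ≤ G (x, T') := by
    intro x
    refine le_trans ?_ (hGlow x T' ⟨by linarith, hT'T⟩)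
    rw [max_eq_left (by linarith)]
    set E := Real.exp ((1 + ‖x - z‖ ^ 2) ^ p / 2)
    have h1 : δ * E ^ 2 - E + 1 / (4 * δ) = δ * (E - 1 / (2 * δ)) ^ 2 := by field_simp; ring
    have h2 : 0 ≤ δ * (E - 1 / (2 * δ)) ^ 2 := by positivity
    linarith
  obtain ⟨R, hR⟩ : ∃ R : ℝ, ∀ x, R < ‖x - z‖ → ∀ t ∈ Ioo 0 T, 0 < G (x, t) := by
    set D := |B| + |m| + 1 with hD
    have hDpos : 0 < D := by positivity
    set E0 := (1 + D) / δ + 1 with hE0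
    have hE0pos : 0 < E0 := by positivity
    have ht := (tendsto_rpow_atTop hp0).eventually_ge_atTop (2 * E0)
    obtain ⟨S, hS⟩ := Filter.eventually_atTop.1 ht
    refine ⟨max S 1, fun x hx t ht => ?_⟩
    refine lt_of_lt_of_le ?_ (hGlow x t ht)
    have hx1 : 1 < ‖x - z‖ := (le_max_right _ _).trans_lt hx
    have hx2 : S < ‖x - z‖ := (le_max_left _ _).trans_lt hx
    have h1 := hS (1 + ‖x - z‖ ^ 2) (by nlinarith)
    have h2 := Real.add_one_le_exp ((1 + ‖x - z‖ ^ 2) ^ p / 2)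
    set E := Real.exp ((1 + ‖x - z‖ ^ 2) ^ p / 2)
    have hE : E0 ≤ E := by linarith
    have h3 : 1 + D ≤ δ * E := by
      have : δ * E0 = 1 + D + δ := by rw [hE0]; field_simp
      nlinarith
    have hE1 : 1 ≤ E := by
      have : 0 ≤ (1 + D) / δ := by positivity
      linarith
    have h4 : 0 ≤ N * (max (t - t₁) 0) ^ 2 := by positivity
    have h5 := le_abs_self B
    have h6 := le_abs_self m
    nlinarith
  -- minimum on compact cylinder
  have hcomp : IsCompact ((Metric.closedBall z R) ×ˢ Icc 0 T') :=
    (isCompact_closedBall z R).prod isCompact_Icc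
  have hmem1 : (x₁, t₁) ∈ (Metric.closedBall z R) ×ˢ Icc 0 T' := by
    refine ⟨?_, ht0.le, h1T'.le⟩
    rw [Metric.mem_closedBall, dist_eq_norm]
    by_contra! h
    have := hR x₁ h t₁ ⟨ht0, htT⟩
    linarith
  have hGlsc : LowerSemicontinuousOn G ((Metric.closedBall z R) ×ˢ Icc 0 T') := by
    have h1 : LowerSemicontinuousOn u ((Metric.closedBall z R) ×ˢ Icc 0 T') :=
      hlsc.mono (prod_mono (subset_univ _) fun t ht => ⟨ht.1, ht.2.trans_lt hT'T⟩)
    refine h1.add ((Continuous.lowerSemicontinuous ?_).lowerSemicontinuousOn _)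
    simp only [hw]
    have : Continuous fun q : EuclideanSpace ℝ (Fin n) × ℝ => (1 + ‖q.1 - z‖ ^ 2) ^ p :=
      Continuous.rpow_const (by fun_prop) (fun q => Or.inr hp0.le)
    fun_prop
  obtain ⟨⟨x₀, t₀⟩, ⟨hx₀, ht₀⟩, hmin⟩ := hGlsc.exists_isMinOn ⟨_, hmem1⟩ hcomp
  have hneg : G (x₀, t₀) < 0 := (hmin hmem1).trans_lt hG1
  have ht₀pos : 0 < t₀ := by
    rcases ht₀.1.eq_or_lt with h | h
    · simp only at h
      rw [← h] at hneg
      linarith [hG0 x₀]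
    · exact h
  have ht₀T' : t₀ < T' := by
    rcases ht₀.2.eq_or_lt with h | h
    · simp only at h
      rw [h] at hneg
      linarith [hGT x₀]
    · exact h
  have ht₀Ω : t₀ ∈ Ioo 0 T := ⟨ht₀pos, ht₀T'.trans hT'T⟩
  -- test function
  set φ : EuclideanSpace ℝ (Fin n) → ℝ → ℝ := fun x t =>
    (m - t * (η * M) - N * (max (t - t₁) 0) ^ 2) +
      (fun τ : ℝ => -(δ * Real.exp (Real.exp (K * t) * τ ^ p))) (1 + ‖x - z‖ ^ 2) with hφ
  have hφG : ∀ q : EuclideanSpace ℝ (Fin n) × ℝ, u q - φ q.1 q.2 = G q := by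
    intro q
    simp only [hφ, hG, hw]; ring
  have hφx : ∀ t, ContDiff ℝ 2 fun x => φ x t := by
    intro t
    have h1 : ContDiff ℝ 2 fun x : EuclideanSpace ℝ (Fin n) => 1 + ‖x - z‖ ^ 2 :=
      contDiff_const.add ((contDiff_id.sub contDiff_const).norm_sq ℝ)
    have h2 : ContDiff ℝ 2 fun x : EuclideanSpace ℝ (Fin n) => (1 + ‖x - z‖ ^ 2) ^ p :=
      h1.rpow_const_of_ne (fun x => by positivity)
    simp only [hφ]
    exact contDiff_const.add
      (contDiff_const.mul (Real.contDiff_exp.comp (contDiff_const.mul h2))).neg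
  have hφt : ∀ x, ContDiff ℝ 1 fun t => φ x t := by
    intro x
    have := aux_pen_contDiff t₁
    simp only [hφ]
    fun_prop
  have hloc : IsLocalMinOn (fun q => u q - φ q.1 q.2) (univ ×ˢ Ioo 0 T) (x₀, t₀) := by
    have hnhds : ∀ᶠ q : EuclideanSpace ℝ (Fin n) × ℝ in nhds (x₀, t₀), q.2 < T' :=
      (continuous_snd.tendsto (x₀, t₀)).eventually (Iio_mem_nhds ht₀T')
    have h2 := hnhds.filter_mono (nhdsWithin_le_nhds (s := univ ×ˢ Ioo 0 T))
    filter_upwards [h2, self_mem_nhdsWithin] with q hq hqΩ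
    rw [hφG]
    rw [hφG]
    obtain ⟨x, t⟩ := q
    by_cases hx : ‖x - z‖ ≤ R
    · exact hmin ⟨by rwa [Metric.mem_closedBall, dist_eq_norm], hqΩ.2.1.le, hq.le⟩
    · have := hR x (not_le.1 hx) t hqΩ.2
      linarith
  have key := hsuper φ hφx hφt x₀ t₀ ⟨mem_univ _, ht₀Ω⟩ hloc
  -- derivatives
  set a := Real.exp (K * t₀) with ha
  have hapos : 0 < a := Real.exp_pos _
  set F1 : ℝ → ℝ := fun τ => -(δ * (Real.exp (a * τ ^ p) * (a * (p * τ ^ (p - 1))))) with hF1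
  have hF : ∀ τ : ℝ, 0 < τ →
      HasDerivAt (fun τ : ℝ => -(δ * Real.exp (a * τ ^ p))) (F1 τ) τ := by
    intro τ hτ
    exact ((((Real.hasDerivAt_rpow_const (Or.inl hτ.ne')).const_mul a).exp).const_mul δ).neg
  have hF1' : ∀ τ : ℝ, 0 < τ → HasDerivAt F1 (deriv F1 τ) τ := by
    intro τ hτ
    rw [hasDerivAt_deriv_iff]
    have h1 : DifferentiableAt ℝ (fun τ : ℝ => τ ^ p) τ :=
      (Real.hasDerivAt_rpow_const (Or.inl hτ.ne')).differentiableAt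
    have h2 : DifferentiableAt ℝ (fun τ : ℝ => τ ^ (p - 1)) τ :=
      (Real.hasDerivAt_rpow_const (Or.inl hτ.ne')).differentiableAt
    simp only [hF1]
    fun_prop
  have hgrad := aux_grad z _ F1 (m - t₀ * (η * M) - N * (max (t₀ - t₁) 0) ^ 2) hF x₀
  have hhess := aux_hess z _ F1 _ (m - t₀ * (η * M) - N * (max (t₀ - t₁) 0) ^ 2) hF hF1' x₀
  set τ₀ := 1 + ‖x₀ - z‖ ^ 2 with hτ₀
  have hτ1 : 1 ≤ τ₀ := by rw [hτ₀]; nlinarith [sq_nonneg ‖x₀ - z‖]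
  have hτpos : 0 < τ₀ := by linarith
  have hdt : deriv (φ x₀) t₀ = - (η * M) - N * (2 * max (t₀ - t₁) 0)
      - δ * (Real.exp (a * τ₀ ^ p) * (a * K * τ₀ ^ p)) := by
    exact (aux_time m (η * M) N t₁ δ K (τ₀ ^ p) t₀).deriv
  simp only [hφ] at key hdt
  simp only [← ha] at key
  rw [hgrad, hhess, hdt] at key
  have hgp : 0 < τ₀ ^ p := by positivity
  have hE := Real.exp_pos (a * τ₀ ^ p)
  have hF1τ : F1 τ₀ = -(δ * (Real.exp (a * τ₀ ^ p) * (a * (p * (τ₀ ^ p / τ₀))))) := by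
    simp only [hF1]; rw [Real.rpow_sub_one hτpos.ne']
  have hF1neg : F1 τ₀ < 0 := by
    rw [hF1τ]; simp only [neg_lt_zero]; positivity
  have hlow := aux_H_lower hn hH hC (2 * F1 τ₀) (4 * deriv F1 τ₀) (Z (u (x₀, t₀)))
    (by linarith) (hZnonneg _) (x₀ - z) ((2 * F1 τ₀) • (x₀ - z))
  have hqn : ‖(2 * F1 τ₀) • (x₀ - z)‖ = -(2 * F1 τ₀) * ‖x₀ - z‖ := by
    rw [norm_smul, Real.norm_eq_abs, abs_of_neg (by linarith)]
  rw [hqn] at key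
  set y := ‖x₀ - z‖
  have hy : 0 ≤ y := norm_nonneg _
  have hr : 0 ≤ -(2 * F1 τ₀) * y := mul_nonneg (by linarith) hy
  have h1 := hyoung _ hr
  have h2 : -M * (η + L * (-(2 * F1 τ₀) * y)) ≤ χ t₀ * (-(2 * F1 τ₀) * y) ^ σ := by
    have h3 : 0 ≤ (-(2 * F1 τ₀) * y) ^ σ := Real.rpow_nonneg hr _
    have h4 := (abs_le.1 (hχ t₀ ht₀Ω)).1
    nlinarith
  -- size of F1
  set W := δ * (Real.exp (a * τ₀ ^ p) * (a * τ₀ ^ p)) with hW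
  have hWpos : 0 < W := by positivity
  have hF1W : F1 τ₀ = -(W * (p / τ₀)) := by rw [hF1τ, hW]; ring
  have hpτ : p / τ₀ ≤ 1 := by rw [div_le_one hτpos]; linarith
  have hpτ0 : 0 < p / τ₀ := by positivity
  have hpy : p / τ₀ * y ≤ 1 := by
    rw [div_mul_eq_mul_div, div_le_one hτpos]
    have : y ≤ τ₀ := by rw [hτ₀]; nlinarith [sq_nonneg (y - 1)]
    nlinarith
  have hb1 : -F1 τ₀ ≤ W := by rw [hF1W]; nlinarith
  have hb2 : -F1 τ₀ * y ≤ W := by rw [hF1W]; nlinarith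
  have hb3 : -F1 τ₀ * |C| ≤ W * |C| := mul_le_mul_of_nonneg_right hb1 (abs_nonneg _)
  have hb4 : (M * L) * (-F1 τ₀ * y) ≤ (M * L) * W := mul_le_mul_of_nonneg_left hb2 (by positivity)
  have hb5 : 0 ≤ N * (2 * max (t₀ - t₁) 0) := by positivity
  have hb6 : δ * (Real.exp (a * τ₀ ^ p) * (a * K * τ₀ ^ p))
      = W * (2 * |C| + 2 * (M * L) + 1) := by rw [hW, ← hK]; ring
  rw [hb6] at key
  linarith

/-- **Theorem 2.10(a),(b)** (minimum principle, `k = 1`, `0 ≤ σ ≤ 1`).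
Since `k₁ = 0`, `H(q,X)` is independent of `q` and we write `H(X) = H(0,X)`.
Both `Λ^sup < ∞` and `Λ^inf > -∞` are assumed. -/
theorem minimum_principle_k_eq_one_sigma_le_one
    (n : ℕ) (hn : 2 ≤ n)
    (H : EuclideanSpace ℝ (Fin n) → Matrix (Fin n) (Fin n) ℝ → ℝ)
    (hH : ConditionsABC n H 0)
    (hΛsup : LambdaSupFinite n H) (hΛinf : LambdaInfFinite n H)
    (T : ℝ) (hT : 0 < T)
    (h : EuclideanSpace ℝ (Fin n) → ℝ) (hhcont : Continuous h)
    (hhbdd : BddBelow (Set.range h))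
    (Z : ℝ → ℝ) (hZcont : Continuous Z) (hZanti : Antitone Z) (hZnonneg : ∀ s, 0 ≤ Z s)
    (χ : ℝ → ℝ) (hχcont : ContinuousOn χ (Ioo 0 T))
    (hχbdd : BddAbove ((fun t => |χ t|) '' Ioo 0 T))
    (σ : ℝ) (hσ0 : 0 ≤ σ) (hσ1 : σ ≤ 1)
    (u : EuclideanSpace ℝ (Fin n) × ℝ → ℝ)
    (hlsc : LowerSemicontinuousOn u (univ ×ˢ Ico 0 T))
    (hsuper : ParabolicSupersolution
      (fun t r q X pt => H 0 (X + Z r • outerProd q) + χ t * ‖q‖ ^ σ - pt)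
      (univ ×ˢ Ioo 0 T) u)
    (hinit : ∀ x, h x ≤ u (x, 0))
    (z : EuclideanSpace ℝ (Fin n)) :
    (σ = 0 →
      (∀ ε > (0:ℝ), ∃ R₀ : ℝ, ∀ R ≥ R₀, ∀ (x : EuclideanSpace ℝ (Fin n)) (t : ℝ),
        ‖x - z‖ ≤ R → t ∈ Ioo 0 T → -u (x, t) ≤ Real.exp (ε * R ^ (2:ℕ))) →
      ∀ (x : EuclideanSpace ℝ (Fin n)), ∀ t ∈ Ioo 0 T,
        (⨅ y, h y) - t * sSup ((fun s => |χ s|) '' Ioo 0 T) ≤ u (x, t)) ∧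
    (0 < σ →
      (∀ ε > (0:ℝ), ∃ R₀ : ℝ, ∀ R ≥ R₀, ∀ (x : EuclideanSpace ℝ (Fin n)) (t : ℝ),
        ‖x - z‖ ≤ R → t ∈ Ioo 0 T → -u (x, t) ≤ Real.exp (ε * R)) →
      ∀ (x : EuclideanSpace ℝ (Fin n)), ∀ t ∈ Ioo 0 T, (⨅ y, h y) ≤ u (x, t)) := by
  have hsSup : ∀ t ∈ Ioo 0 T, |χ t| ≤ sSup ((fun s => |χ s|) '' Ioo 0 T) := fun t ht =>
    le_csSup hχbdd ⟨t, ht, rfl⟩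
  have hM0 : 0 ≤ sSup ((fun s => |χ s|) '' Ioo 0 T) :=
    (abs_nonneg _).trans (hsSup (T / 2) ⟨by linarith, by linarith⟩)
  have hm : ∀ x, (⨅ y, h y) ≤ u (x, 0) := fun x => (ciInf_le hhbdd x).trans (hinit x)
  constructor
  · intro hσ hg x t ht
    have hgrow : ∃ B : ℝ, ∀ x, ∀ t ∈ Ioo 0 T,
        -u (x, t) ≤ B + Real.exp ((1 + ‖x - z‖ ^ 2) ^ (1:ℝ) / 2) := by
      obtain ⟨R₀, hR₀⟩ := hg (1 / 2) (by norm_num)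
      refine ⟨Real.exp (1 / 2 * R₀ ^ 2), fun x t ht => ?_⟩
      rw [Real.rpow_one]
      rcases le_total R₀ ‖x - z‖ with hx | hx
      · refine (hR₀ _ hx x t le_rfl ht).trans ?_
        have h1 : Real.exp (1 / 2 * ‖x - z‖ ^ 2) ≤ Real.exp ((1 + ‖x - z‖ ^ 2) / 2) :=
          Real.exp_le_exp.2 (by linarith)
        linarith [Real.exp_pos (1 / 2 * R₀ ^ 2)]
      · have := hR₀ R₀ le_rfl x t hx ht
        linarith [Real.exp_pos ((1 + ‖x - z‖ ^ 2) / 2)]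
    have := aux_core n hn H hH hΛinf T Z hZnonneg χ _ hM0 hsSup σ u hlsc hsuper _ hm z 1 0
      zero_le_one le_rfl (fun r _ => by simp [hσ]) 1 one_pos le_rfl hgrow x t ht
    simpa using this
  · intro hσ hg x t ht
    have hgrow : ∃ B : ℝ, ∀ x, ∀ t ∈ Ioo 0 T,
        -u (x, t) ≤ B + Real.exp ((1 + ‖x - z‖ ^ 2) ^ (1 / 2 : ℝ) / 2) := by
      obtain ⟨R₀, hR₀⟩ := hg (1 / 2) (by norm_num)
      refine ⟨Real.exp (1 / 2 * R₀), fun x t ht => ?_⟩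
      rw [← Real.sqrt_eq_rpow]
      rcases le_total R₀ ‖x - z‖ with hx | hx
      · refine (hR₀ _ hx x t le_rfl ht).trans ?_
        have h0 : ‖x - z‖ ≤ √(1 + ‖x - z‖ ^ 2) := Real.le_sqrt_of_sq_le (by linarith)
        have h1 : Real.exp (1 / 2 * ‖x - z‖) ≤ Real.exp (√(1 + ‖x - z‖ ^ 2) / 2) :=
          Real.exp_le_exp.2 (by linarith)
        linarith [Real.exp_pos (1 / 2 * R₀)]
      · have := hR₀ R₀ le_rfl x t hx ht
        linarith [Real.exp_pos (√(1 + ‖x - z‖ ^ 2) / 2)]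
    have hall : ∀ η : ℝ, 0 < η →
        (⨅ y, h y) - t * (η * sSup ((fun s => |χ s|) '' Ioo 0 T)) ≤ u (x, t) := by
      intro η hη
      obtain ⟨L, hL, hy⟩ := aux_young σ hσ hσ1 η hη
      exact aux_core n hn H hH hΛinf T Z hZnonneg χ _ hM0 hsSup σ u hlsc hsuper _ hm z η L
        hη.le hL hy (1 / 2) (by norm_num) (by norm_num) hgrow x t ht
    set M := sSup ((fun s => |χ s|) '' Ioo 0 T)
    refine le_of_forall_pos_le_add fun ε hε => ?_
    have hpos : 0 < t * M + 1 := by have := mul_nonneg ht.1.le hM0; linarith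
    have h1 := hall (ε / (t * M + 1)) (by positivity)
    have h2 : t * (ε / (t * M + 1) * M) ≤ ε := by
      have : t * (ε / (t * M + 1) * M) = ε * (t * M) / (t * M + 1) := by ring
      rw [this, div_le_iff₀ hpos]
      nlinarith
    linarith
end
end

section
/- Minimum principle, case k=1, σ>1, with no lower bound on Λ^inf (Theorem 2.10(c)): Suppose H satisfies Conditions A–C with k₁ = 0 (so k = 1, γ = 2; H(q,X) is then independent of q and is written H(X)) and Λ^sup < ∞ (no assumption on Λ^inf). Let h : ℝⁿ → ℝ be continuous with inf_{ℝⁿ} h > −∞, let Z : (−∞,∞) → [0,∞) be continuous and non-increasing, let χ : (0,T) → ℝ be bounded and continuous, and let 1 < σ < ∞. Let u be lower semicontinuous on ℝⁿ × [0,T), a viscosity supersolution of H(D²u + Z(u)Du⊗Du) + χ(t)|Du|^σ − u_t = 0 in ℝⁿ_T, with u(x,0) ≥ h(x) for all x ∈ ℝⁿ. If sup_{B^R_T}(−u) = o(R^{σ*}) as R → ∞, then u(x,t) ≥ inf_{ℝⁿ} h for all (x,t) ∈ ℝⁿ_T. -/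
open Set MeasureTheory

noncomputable section

section Aux

variable {n : ℕ}

/-- The growth function. -/
def vfun (z : EuclideanSpace ℝ (Fin n)) (p : ℝ) (x : EuclideanSpace ℝ (Fin n)) : ℝ :=
  (1 + ‖x - z‖ ^ 2) ^ p

lemma base_pos (z x : EuclideanSpace ℝ (Fin n)) : 0 < 1 + ‖x - z‖ ^ 2 := by positivity

lemma vfun_contDiff (z : EuclideanSpace ℝ (Fin n)) (p : ℝ) {m : ℕ∞} :
    ContDiff ℝ m (vfun z p) := by
  unfold vfun
  apply ContDiff.rpow_const_of_ne
  · exact contDiff_const.add ((contDiff_id.sub contDiff_const).norm_sq ℝ)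
  · intro x; exact (base_pos z x).ne'

lemma vfun_hasFDerivAt (z : EuclideanSpace ℝ (Fin n)) (p : ℝ) (x : EuclideanSpace ℝ (Fin n)) :
    HasFDerivAt (vfun z p)
      ((2 * p * (1 + ‖x - z‖ ^ 2) ^ (p - 1)) • (innerSL ℝ (x - z))) x := by
  have h1 : HasFDerivAt (fun y : EuclideanSpace ℝ (Fin n) => 1 + ‖y - z‖ ^ 2)
      (2 • innerSL ℝ (x - z)) x := by
    have := ((hasFDerivAt_id x).sub_const z).norm_sq.const_add 1
    simpa using this
  have h2 := h1.rpow_const (p := p) (Or.inl (base_pos z x).ne')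
  refine h2.congr_fderiv ?_
  ext w
  simp
  ring

lemma vfun_fderiv_single (z : EuclideanSpace ℝ (Fin n)) (p : ℝ) (x : EuclideanSpace ℝ (Fin n))
    (j : Fin n) : fderiv ℝ (vfun z p) x (EuclideanSpace.single j 1) =
      2 * p * vfun z (p - 1) x * (x j - z j) := by
  rw [(vfun_hasFDerivAt z p x).fderiv]
  simp [vfun, EuclideanSpace.inner_single_right]

lemma test_grad (z : EuclideanSpace ℝ (Fin n)) (p c b : ℝ) (x : EuclideanSpace ℝ (Fin n)) :
    spaceGrad (fun x => c - b * vfun z p x) x = (-(b * (2 * p * vfun z (p - 1) x))) • (x - z) := by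
  have hd : DifferentiableAt ℝ (vfun z p) x := (vfun_hasFDerivAt z p x).differentiableAt
  ext j
  simp only [spaceGrad]
  rw [fderiv_const_sub, fderiv_const_mul hd]
  simp [vfun_fderiv_single]
  ring

lemma test_hess (z : EuclideanSpace ℝ (Fin n)) (p c b : ℝ) (x : EuclideanSpace ℝ (Fin n)) :
    spaceHess (fun x => c - b * vfun z p x) x =
      (-(b * (2 * p * vfun z (p - 1) x))) • (1 : Matrix (Fin n) (Fin n) ℝ) +
      (-(b * (4 * p * (p - 1) * vfun z (p - 2) x))) • outerProd (x - z) := by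
  ext i j
  have e : (fun y => fderiv ℝ (fun x => c - b * vfun z p x) y (EuclideanSpace.single j 1)) =
      fun y => (-(b * (2 * p))) * (vfun z (p - 1) y * (y j - z j)) := by
    funext y
    have hd : DifferentiableAt ℝ (vfun z p) y := (vfun_hasFDerivAt z p y).differentiableAt
    rw [fderiv_const_sub, fderiv_const_mul hd]
    simp [vfun_fderiv_single]
    ring
  have h1 := vfun_hasFDerivAt z (p - 1) x
  have h2 : HasFDerivAt (fun y : EuclideanSpace ℝ (Fin n) => y j - z j)
      (EuclideanSpace.proj j : EuclideanSpace ℝ (Fin n) →L[ℝ] ℝ) x :=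
    ((EuclideanSpace.proj j : EuclideanSpace ℝ (Fin n) →L[ℝ] ℝ).hasFDerivAt).sub_const _
  have h3 := (h1.mul h2).const_mul (-(b * (2 * p)))
  simp only [spaceHess, Matrix.of_apply]
  rw [e]
  have h4 := h3.fderiv
  simp only [Pi.mul_apply] at h4
  erw [h4]
  have e2 : p - 1 - 1 = p - 2 := by ring
  by_cases hij : i = j
  · subst hij
    simp [outerProd, vfun, EuclideanSpace.inner_single_right, e2]
    ring
  · simp [outerProd, vfun, EuclideanSpace.inner_single_right, e2, hij, Ne.symm hij]
    ring

lemma outer_isSymm (q : EuclideanSpace ℝ (Fin n)) : (outerProd q).IsSymm := by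
  ext i j; simp [outerProd, mul_comm]

lemma outer_quad (q : EuclideanSpace ℝ (Fin n)) (w : Fin n → ℝ) :
    star w ⬝ᵥ (outerProd q).mulVec w = (∑ i, q i * w i) ^ 2 := by
  simp only [dotProduct, Matrix.mulVec, outerProd, Matrix.of_apply, sq,
    Pi.star_apply, star_trivial]
  rw [Finset.sum_mul_sum]
  refine Finset.sum_congr rfl fun i _ => ?_
  rw [Finset.mul_sum]
  refine Finset.sum_congr rfl fun j _ => by ring

lemma cs_quad (q : EuclideanSpace ℝ (Fin n)) (w : Fin n → ℝ) :
    (∑ i, q i * w i) ^ 2 ≤ ‖q‖ ^ 2 * ∑ i, w i ^ 2 := by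
  rw [EuclideanSpace.real_norm_sq_eq]
  exact Finset.sum_mul_sq_le_sq_mul_sq _ _ _

/-- Loewner lower bound for the test matrix. -/
lemma loewner_bound (q : EuclideanSpace ℝ (Fin n)) (α β C : ℝ)
    (h : α + |β| * ‖q‖ ^ 2 ≤ C) (r : ℝ) (hr : 0 ≤ r) (q' : EuclideanSpace ℝ (Fin n)) :
    LoewnerLE (C • (-1 : Matrix (Fin n) (Fin n) ℝ))
      (((-α) • (1 : Matrix (Fin n) (Fin n) ℝ) + (-β) • outerProd q) + r • outerProd q') := by
  unfold LoewnerLE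
  rw [Matrix.posSemidef_iff_dotProduct_mulVec]
  constructor
  · rw [Matrix.IsHermitian, Matrix.conjTranspose_eq_transpose_of_trivial]
    simp [(outer_isSymm q).eq, (outer_isSymm q').eq]
  · intro w
    simp only [Matrix.sub_mulVec, Matrix.add_mulVec, Matrix.smul_mulVec, dotProduct_add,
      dotProduct_sub, dotProduct_smul, outer_quad, Matrix.neg_mulVec, Matrix.one_mulVec,
      dotProduct_neg, smul_eq_mul]
    have e : star w ⬝ᵥ w = ∑ i, w i ^ 2 := by simp [dotProduct, sq]
    rw [e]
    have hS : 0 ≤ ∑ i, w i ^ 2 := Finset.sum_nonneg fun i _ => sq_nonneg _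
    have h1 := cs_quad q w
    have h2 : β * (∑ i, q i * w i) ^ 2 ≤ |β| * (‖q‖ ^ 2 * ∑ i, w i ^ 2) :=
      (mul_le_mul_of_nonneg_right (le_abs_self β) (sq_nonneg _)).trans
        (mul_le_mul_of_nonneg_left h1 (abs_nonneg _))
    have h3 := mul_le_mul_of_nonneg_right h hS
    have h4 : 0 ≤ r * (∑ i, q' i * w i) ^ 2 := by positivity
    nlinarith

lemma vfun_mono_exp (z x : EuclideanSpace ℝ (Fin n)) {a b : ℝ} (h : a ≤ b) :
    vfun z a x ≤ vfun z b x :=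
  Real.rpow_le_rpow_of_exponent_le (by nlinarith [sq_nonneg ‖x - z‖]) h

lemma vfun_pos (z x : EuclideanSpace ℝ (Fin n)) (a : ℝ) : 0 < vfun z a x :=
  Real.rpow_pos_of_pos (base_pos z x) _

lemma vfun_two (z x : EuclideanSpace ℝ (Fin n)) (p : ℝ) :
    vfun z (p - 2) x * ‖x - z‖ ^ 2 ≤ vfun z p x := by
  have h1 : vfun z (p - 2) x * (1 + ‖x - z‖ ^ 2) = vfun z (p - 1) x := by
    unfold vfun
    rw [← Real.rpow_add_one (base_pos z x).ne']; congr 1; ring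
  have h2 := vfun_mono_exp z x (show p - 1 ≤ p by linarith)
  have := vfun_pos z x (p - 2)
  nlinarith

lemma grad_pow (z x : EuclideanSpace ℝ (Fin n)) (σ p b : ℝ) (hσ : 1 < σ)
    (hp : p = σ / (σ - 1) / 2) (hb : 0 < b) (hb1 : b ≤ 1) :
    ‖(-(b * (2 * p * vfun z (p - 1) x))) • (x - z)‖ ^ σ ≤ b * ((2 * p) ^ σ * vfun z p x) := by
  have hs1 : 0 < σ - 1 := by linarith
  have hp0 : 0 < p := by rw [hp]; positivity
  have hs := base_pos z x
  have hv := vfun_pos z x (p - 1)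
  have hr : ‖x - z‖ ≤ (1 + ‖x - z‖ ^ 2) ^ (1 / 2 : ℝ) := by
    rw [← Real.sqrt_eq_rpow]
    exact Real.le_sqrt_of_sq_le (by linarith)
  have hbase : vfun z (p - 1) x * ‖x - z‖ ≤ (1 + ‖x - z‖ ^ 2) ^ (p - 1 / 2) := by
    calc _ ≤ vfun z (p - 1) x * (1 + ‖x - z‖ ^ 2) ^ (1 / 2 : ℝ) :=
          mul_le_mul_of_nonneg_left hr hv.le
      _ = _ := by
        unfold vfun
        rw [← Real.rpow_add hs]; congr 1; ring
  rw [norm_smul, Real.norm_eq_abs, abs_neg, abs_of_pos (by positivity)]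
  have e : b * (2 * p * vfun z (p - 1) x) * ‖x - z‖
      = b * ((2 * p) * (vfun z (p - 1) x * ‖x - z‖)) := by ring
  rw [e, Real.mul_rpow hb.le (by positivity), Real.mul_rpow (by positivity) (by positivity)]
  have hbσ : b ^ σ ≤ b := by
    simpa using Real.rpow_le_rpow_of_exponent_ge hb hb1 hσ.le
  have hvσ : (vfun z (p - 1) x * ‖x - z‖) ^ σ ≤ vfun z p x := by
    calc _ ≤ ((1 + ‖x - z‖ ^ 2) ^ (p - 1 / 2)) ^ σ :=
          Real.rpow_le_rpow (by positivity) hbase (by linarith)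
      _ = _ := by
        unfold vfun
        rw [← Real.rpow_mul hs.le]; congr 1; rw [hp]; field_simp; ring
  gcongr

end Aux

set_option maxHeartbeats 2000000 in
/-- **Theorem 2.10(c)** (minimum principle, `k = 1`, `σ > 1`, no assumption on `Λ^inf`).
Since `k₁ = 0`, `H(q,X)` is independent of `q` and we write `H(X) = H(0,X)`;
`σ* = σ/(σ-1)`. -/
theorem minimum_principle_k_eq_one_sigma_gt_one
    (n : ℕ) (hn : 2 ≤ n)
    (H : EuclideanSpace ℝ (Fin n) → Matrix (Fin n) (Fin n) ℝ → ℝ)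
    (hH : ConditionsABC n H 0)
    (hΛsup : LambdaSupFinite n H)
    (T : ℝ) (hT : 0 < T)
    (h : EuclideanSpace ℝ (Fin n) → ℝ) (hhcont : Continuous h)
    (hhbdd : BddBelow (Set.range h))
    (Z : ℝ → ℝ) (hZcont : Continuous Z) (hZanti : Antitone Z) (hZnonneg : ∀ s, 0 ≤ Z s)
    (χ : ℝ → ℝ) (hχcont : ContinuousOn χ (Ioo 0 T))
    (hχbdd : BddAbove ((fun t => |χ t|) '' Ioo 0 T))
    (σ : ℝ) (hσ : 1 < σ)
    (u : EuclideanSpace ℝ (Fin n) × ℝ → ℝ)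
    (hlsc : LowerSemicontinuousOn u (univ ×ˢ Ico 0 T))
    (hsuper : ParabolicSupersolution
      (fun t r q X pt => H 0 (X + Z r • outerProd q) + χ t * ‖q‖ ^ σ - pt)
      (univ ×ˢ Ioo 0 T) u)
    (hinit : ∀ x, h x ≤ u (x, 0))
    (z : EuclideanSpace ℝ (Fin n))
    (hgrow : ∀ ε > (0:ℝ), ∃ R₀ : ℝ, ∀ R ≥ R₀, ∀ (x : EuclideanSpace ℝ (Fin n)) (t : ℝ),
      ‖x - z‖ ≤ R → t ∈ Ioo 0 T → -u (x, t) ≤ ε * R ^ (σ / (σ - 1))) :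
    ∀ (x : EuclideanSpace ℝ (Fin n)), ∀ t ∈ Ioo 0 T, (⨅ y, h y) ≤ u (x, t) := by

  obtain ⟨K₀, hK₀⟩ := hχbdd
  set K : ℝ := max K₀ 0 with hKdef
  have hK : ∀ t ∈ Ioo 0 T, |χ t| ≤ K := fun t ht =>
    (hK₀ ⟨t, ht, rfl⟩).trans (le_max_left _ _)
  have hKnn : 0 ≤ K := le_max_right _ _
  set m : ℝ := ⨅ y, h y with hm
  have hmle : ∀ x, m ≤ u (x, 0) := fun x => (ciInf_le hhbdd x).trans (hinit x)
  have hs1 : 0 < σ - 1 := by linarith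
  obtain ⟨p, hp⟩ : ∃ p : ℝ, p = σ / (σ - 1) / 2 := ⟨_, rfl⟩
  have hp0 : 0 < p := by rw [hp]; positivity
  have h2p : σ / (σ - 1) = 2 * p := by rw [hp]; ring
  have h2p1 : 1 ≤ 2 * p := by
    rw [← h2p, le_div_iff₀ hs1]; linarith
  rw [h2p] at hgrow
  set C₁ : ℝ := 2 * p + |4 * p * (p - 1)| with hC₁
  have hC₁p : 0 < C₁ := by positivity
  set c₀ : ℝ := |H 0 (-1)| with hc₀
  set L : ℝ := C₁ * c₀ + K * (2 * p) ^ σ + 1 with hL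
  have hLp : 0 < L := by positivity
  intro x₁ t₁ ht₁
  -- the main estimate for small ε
  have key : ∀ ε : ℝ, 0 < ε → ε ≤ Real.exp (-(L * T)) →
      m ≤ u (x₁, t₁) + ε * (Real.exp (L * t₁) * vfun z p x₁) := by
    intro ε hε hεle
    by_contra hcon
    push Not at hcon
    obtain ⟨η, hη, hηlt⟩ : ∃ η : ℝ, 0 < η ∧
        u (x₁, t₁) + ε * (Real.exp (L * t₁) * vfun z p x₁) + η < m :=
      ⟨(m - (u (x₁, t₁) + ε * (Real.exp (L * t₁) * vfun z p x₁))) / 2, by linarith, by linarith⟩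
    obtain ⟨R₀, hR₀⟩ := hgrow (ε / 2) (by positivity)
    set R : ℝ := max R₀ (max 1 (2 * |m| / ε + 1)) with hR
    have hRR₀ : R₀ ≤ R := le_max_left _ _
    have hR1 : 1 ≤ R := (le_max_left _ _).trans (le_max_right _ _)
    have hRm : 2 * |m| / ε + 1 ≤ R := (le_max_right _ _).trans (le_max_right _ _)
    set M : ℝ := ε / 2 * R ^ (2 * p) + |m| with hM
    have hMnn : 0 ≤ M := by positivity
    obtain ⟨T', hT'1, hT'2⟩ := exists_between ht₁.2
    obtain ⟨κ, hκ, hκM⟩ : ∃ κ : ℝ, 0 < κ ∧ M < η * Real.exp (κ * (T' - t₁)) := by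
      refine ⟨(M / η + 1) / (T' - t₁), div_pos (by positivity) (by linarith), ?_⟩
      rw [div_mul_cancel₀ _ (by linarith : T' - t₁ ≠ 0)]
      have := Real.add_one_le_exp (M / η + 1)
      calc M = η * (M / η) := by field_simp
        _ < η * Real.exp (M / η + 1) := by
          apply mul_lt_mul_of_pos_left _ hη; linarith
    -- the test function
    let φ : EuclideanSpace ℝ (Fin n) → ℝ → ℝ := fun x t =>
      (m - η * Real.exp (κ * (t - t₁))) - (ε * Real.exp (L * t)) * vfun z p x
    have hexp1 : ∀ t : ℝ, 0 ≤ t → 1 ≤ Real.exp (L * t) := fun t ht =>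
      Real.one_le_exp (by positivity)
    have hvr : ∀ x, ‖x - z‖ ^ (2 * p) ≤ vfun z p x := by
      intro x
      unfold vfun
      rw [Real.rpow_mul (norm_nonneg _)]
      apply Real.rpow_le_rpow (by positivity) _ hp0.le
      rw [Real.rpow_two]; linarith
    -- positivity far away
    have hfar : ∀ x t, t ∈ Ioo 0 T → R ≤ ‖x - z‖ → 0 < u (x, t) - φ x t := by
      intro x t ht hx
      have h1 := hR₀ ‖x - z‖ (hRR₀.trans hx) x t le_rfl ht
      have h2 := hvr x
      have h3 : ‖x - z‖ ≤ ‖x - z‖ ^ (2 * p) := by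
        simpa using Real.rpow_le_rpow_of_exponent_le (hR1.trans hx) h2p1
      have h4 : 2 * |m| / ε + 1 ≤ ‖x - z‖ := hRm.trans hx
      have h5 : 2 * |m| < ε * ‖x - z‖ := by
        have : 2 * |m| / ε < ‖x - z‖ := by linarith
        rw [div_lt_iff₀ hε] at this; linarith
      have h6 : ε * ‖x - z‖ ≤ ε * ‖x - z‖ ^ (2 * p) := mul_le_mul_of_nonneg_left h3 hε.le
      have h7 : ε * ‖x - z‖ ^ (2 * p) ≤ (ε * Real.exp (L * t)) * vfun z p x := by
        rw [mul_assoc]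
        apply mul_le_mul_of_nonneg_left _ hε.le
        nlinarith [hexp1 t ht.1.le, vfun_pos z x p]
      have h8 : 0 < η * Real.exp (κ * (t - t₁)) := by positivity
      have := le_abs_self m
      simp only [φ]
      linarith
    have hlate : ∀ x t, t ∈ Ioo 0 T → T' ≤ t → ‖x - z‖ ≤ R → 0 < u (x, t) - φ x t := by
      intro x t ht hTt hx
      have h1 := hR₀ R hRR₀ x t hx ht
      have h2 : η * Real.exp (κ * (T' - t₁)) ≤ η * Real.exp (κ * (t - t₁)) := by gcongr
      have h3 : 0 < (ε * Real.exp (L * t)) * vfun z p x :=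
        mul_pos (by positivity) (vfun_pos _ _ _)
      have := le_abs_self m
      simp only [φ]
      linarith
    have hzero : ∀ x, 0 < u (x, 0) - φ x 0 := by
      intro x
      have h1 := hmle x
      have h3 : 0 < (ε * Real.exp (L * 0)) * vfun z p x :=
        mul_pos (by positivity) (vfun_pos _ _ _)
      have h8 : 0 < η * Real.exp (κ * (0 - t₁)) := by positivity
      simp only [φ]
      linarith
    have hneg : u (x₁, t₁) - φ x₁ t₁ < 0 := by
      simp only [φ, sub_self, mul_zero, Real.exp_zero]
      linarith
    have hvc : Continuous (vfun z p) := (vfun_contDiff z p (m := 0)).continuous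
    have hφc : Continuous fun q : EuclideanSpace ℝ (Fin n) × ℝ => -φ q.1 q.2 := by
      simp only [φ]
      fun_prop
    set S : Set (EuclideanSpace ℝ (Fin n) × ℝ) := Metric.closedBall z R ×ˢ Icc 0 T' with hS
    have hScomp : IsCompact S := (isCompact_closedBall z R).prod isCompact_Icc
    have hx₁R : ‖x₁ - z‖ < R := by
      by_contra hc
      exact absurd (hfar x₁ t₁ ht₁ (not_lt.1 hc)) (not_lt.2 hneg.le)
    have hmem₁ : (x₁, t₁) ∈ S := by
      refine ⟨?_, ht₁.1.le, hT'1.le⟩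
      rw [mem_closedBall_iff_norm]; exact hx₁R.le
    have hlscS : LowerSemicontinuousOn
        (fun q : EuclideanSpace ℝ (Fin n) × ℝ => u q + -φ q.1 q.2) S := by
      apply LowerSemicontinuousOn.add
      · refine hlsc.mono ?_
        rintro ⟨a, t⟩ ⟨_, ht⟩
        exact ⟨mem_univ _, ht.1, ht.2.trans_lt hT'2⟩
      · exact hφc.lowerSemicontinuous.lowerSemicontinuousOn _
    obtain ⟨⟨x₀, t₀⟩, hmem₀, hmin⟩ := hlscS.exists_isMinOn ⟨_, hmem₁⟩ hScomp
    have hmin' : ∀ x t, (x, t) ∈ S → u (x₀, t₀) - φ x₀ t₀ ≤ u (x, t) - φ x t := by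
      intro x t hxt
      have := isMinOn_iff.1 hmin (x, t) hxt
      simpa [sub_eq_add_neg] using this
    have hneg₀ : u (x₀, t₀) - φ x₀ t₀ < 0 := (hmin' _ _ hmem₁).trans_lt hneg
    have ht₀0 : 0 < t₀ := by
      rcases hmem₀.2.1.lt_or_eq with h' | h'
      · exact h'
      · exfalso
        have h' : (0 : ℝ) = t₀ := h'
        subst h'
        exact absurd (hzero x₀) (not_lt.2 hneg₀.le)
    have ht₀T' : t₀ ≤ T' := hmem₀.2.2
    have ht₀ : t₀ ∈ Ioo 0 T := ⟨ht₀0, ht₀T'.trans_lt hT'2⟩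
    have hglob : IsLocalMinOn (fun q : EuclideanSpace ℝ (Fin n) × ℝ => u q - φ q.1 q.2)
        (univ ×ˢ Ioo 0 T) (x₀, t₀) := by
      apply IsMinOn.localize
      rw [isMinOn_iff]
      rintro ⟨x, t⟩ ⟨_, ht⟩
      change u (x₀, t₀) - φ x₀ t₀ ≤ u (x, t) - φ x t
      have ht : t ∈ Ioo 0 T := ht
      rcases le_total R ‖x - z‖ with hx | hx
      · exact (hneg₀.trans (hfar x t ht hx)).le
      · rcases le_total T' t with hTt | hTt
        · exact (hneg₀.trans (hlate x t ht hTt hx)).le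
        · apply hmin'
          exact ⟨by rw [mem_closedBall_iff_norm]; exact hx, ht.1.le, hTt⟩
    have hvis := hsuper φ
      (fun t => contDiff_const.sub (contDiff_const.mul (vfun_contDiff z p (m := 2))))
      (fun x => by simp only [φ]; fun_prop) x₀ t₀ ⟨mem_univ _, ht₀⟩ hglob
    -- contradiction
    set b : ℝ := ε * Real.exp (L * t₀) with hb
    have hbp : 0 < b := by positivity
    have hb1 : b ≤ 1 := by
      calc b ≤ Real.exp (-(L * T)) * Real.exp (L * t₀) := by rw [hb]; gcongr
        _ = Real.exp (-(L * T) + L * t₀) := (Real.exp_add _ _).symm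
        _ ≤ 1 := by
          rw [Real.exp_le_one_iff]
          nlinarith [ht₀.2]
    have hgrad : spaceGrad (fun x => φ x t₀) x₀ =
        (-(b * (2 * p * vfun z (p - 1) x₀))) • (x₀ - z) := test_grad z p _ b x₀
    have hhess : spaceHess (fun x => φ x t₀) x₀ =
        (-(b * (2 * p * vfun z (p - 1) x₀))) • (1 : Matrix (Fin n) (Fin n) ℝ) +
        (-(b * (4 * p * (p - 1) * vfun z (p - 2) x₀))) • outerProd (x₀ - z) :=
      test_hess z p _ b x₀
    have hderiv : deriv (φ x₀) t₀ =
        -(η * (Real.exp (κ * (t₀ - t₁)) * κ)) - b * L * vfun z p x₀ := by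
      have d1 : HasDerivAt (fun t : ℝ => Real.exp (κ * (t - t₁)))
          (Real.exp (κ * (t₀ - t₁)) * (κ * 1)) t₀ :=
        (((hasDerivAt_id t₀).sub_const t₁).const_mul κ).exp
      have d2 : HasDerivAt (fun t : ℝ => Real.exp (L * t))
          (Real.exp (L * t₀) * (L * 1)) t₀ := ((hasDerivAt_id t₀).const_mul L).exp
      have d3 := ((d1.const_mul η).const_sub m).sub ((d2.const_mul ε).mul_const (vfun z p x₀))
      have d4 := d3.deriv
      refine Eq.trans d4 ?_
      rw [hb]; ring
    simp only [hderiv, hhess] at hvis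
    rw [hgrad] at hvis
    set q := (-(b * (2 * p * vfun z (p - 1) x₀))) • (x₀ - z) with hq
    have hvp := vfun_pos z x₀ p
    have hloew := loewner_bound (x₀ - z) (b * (2 * p * vfun z (p - 1) x₀))
      (b * (4 * p * (p - 1) * vfun z (p - 2) x₀)) (b * C₁ * vfun z p x₀) (by
        rw [abs_mul, abs_of_pos hbp, abs_mul, abs_of_pos (vfun_pos z x₀ (p - 2))]
        have h1 := vfun_mono_exp z x₀ (show p - 1 ≤ p by linarith)
        have h2 := vfun_two z x₀ p
        calc _ = b * (2 * p * vfun z (p - 1) x₀ +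
              |4 * p * (p - 1)| * (vfun z (p - 2) x₀ * ‖x₀ - z‖ ^ 2)) := by ring
          _ ≤ b * (2 * p * vfun z p x₀ + |4 * p * (p - 1)| * vfun z p x₀) := by gcongr
          _ = _ := by rw [hC₁]; ring) (Z (u (x₀, t₀))) (hZnonneg _) q
    have hmono := hH.monotone 0 _ _ (by simp [Matrix.IsSymm])
      (by simp [Matrix.IsSymm, (outer_isSymm (x₀ - z)).eq, (outer_isSymm q).eq]) hloew
    rw [hH.hom_X _ (by positivity)] at hmono
    have hHm : -c₀ ≤ H 0 (-1) := neg_abs_le _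
    have hA : 0 < b * C₁ * vfun z p x₀ := by positivity
    have hH1 : b * C₁ * vfun z p x₀ * (-c₀) ≤ b * C₁ * vfun z p x₀ * H 0 (-1) :=
      mul_le_mul_of_nonneg_left hHm hA.le
    have hG : ‖q‖ ^ σ ≤ b * ((2 * p) ^ σ * vfun z p x₀) :=
      grad_pow z x₀ σ p b hσ hp hbp hb1
    have hχ1 : -K ≤ χ t₀ := (neg_le_neg (hK t₀ ht₀)).trans (neg_abs_le _)
    have hqn : 0 ≤ ‖q‖ ^ σ := by positivity
    have hX1 : -K * ‖q‖ ^ σ ≤ χ t₀ * ‖q‖ ^ σ := mul_le_mul_of_nonneg_right hχ1 hqn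
    have hX2 : K * ‖q‖ ^ σ ≤ K * (b * ((2 * p) ^ σ * vfun z p x₀)) :=
      mul_le_mul_of_nonneg_left hG hKnn
    have hE : 0 < η * (Real.exp (κ * (t₀ - t₁)) * κ) := by positivity
    have hLe : b * L * vfun z p x₀ = b * C₁ * vfun z p x₀ * c₀ +
        K * (b * ((2 * p) ^ σ * vfun z p x₀)) + b * vfun z p x₀ := by rw [hL]; ring
    have hbv : 0 < b * vfun z p x₀ := by positivity
    linarith
  -- let ε → 0
  apply le_of_forall_pos_le_add
  intro δ hδ
  set A : ℝ := Real.exp (L * t₁) * vfun z p x₁ with hA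
  have hAp : 0 < A := mul_pos (Real.exp_pos _) (vfun_pos _ _ _)
  have h1 := key (min (Real.exp (-(L * T))) (δ / A)) (lt_min (Real.exp_pos _) (by positivity))
    (min_le_left _ _)
  have h2 : min (Real.exp (-(L * T))) (δ / A) * A ≤ δ := by
    calc _ ≤ δ / A * A := mul_le_mul_of_nonneg_right (min_le_right _ _) hAp.le
      _ = δ := by field_simp
  linarith
end
end
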